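/- There exist constants C₀, C > 0 independent of ε and N such that, if ε ≤ C₀ N^{−1}, then the unique solution ȳ ∈ ℝ^{N+1} of T ȳ = 0 on the modified Shishkin mesh satisfies: |y(x_i) − ȳ_i| ≤ C (ln² N)/N² for i = 0,…,N/4−1; |y(x_i) − ȳ_i| ≤ C/N² for i = N/4,…,3N/4; and |y(x_i) − ȳ_i| ≤ C (ln² N)/N² for i = 3N/4+1,…,N, where y is the exact solution of the boundary value problem. -/

import Mathlib

/-- The modified Shishkin (Vulanović) mesh-generating function. -/
noncomputable def shishkinPsi (lam t : ℝ) : ℝ :=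
  if t ≤ 1 / 2 then
    (if t ≤ 1 / 4 then 4 * lam * t
     else 32 * (1 - 4 * lam) * (t - 1 / 4) ^ 3 + 4 * lam * t)
  else
    1 - (if 1 - t ≤ 1 / 4 then 4 * lam * (1 - t)
         else 32 * (1 - 4 * lam) * ((1 - t) - 1 / 4) ^ 3 + 4 * lam * (1 - t))

/-- `A(h) = (cosh(βh) − 1)/sinh(βh)`. -/
noncomputable def Acoef (β h : ℝ) : ℝ := (Real.cosh (β * h) - 1) / Real.sinh (β * h)

/-- `B(h) = (cosh(βh) + 1)/sinh(βh)`. -/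
noncomputable def Bcoef (β h : ℝ) : ℝ := (Real.cosh (β * h) + 1) / Real.sinh (β * h)

/-- The `i`-th component of the discrete operator `T` generated by the difference
scheme: `Tu_0 = -u_0`, `Tu_N = -u_N`, and for interior `i`,
`Tu_i = γ/(A(h_{i-1})+A(h_i)) · [ B(h_{i-1})u_{i-1} − (B(h_{i-1})+B(h_i))u_i + B(h_i)u_{i+1}`
`− (f(x_{i-1},u_{i-1})+f(x_i,u_i))A(h_{i-1})/γ − (f(x_i,u_i)+f(x_{i+1},u_{i+1}))A(h_i)/γ ]`. -/
noncomputable def Tdisc (f : ℝ → ℝ → ℝ) (γ β : ℝ) (x : ℕ → ℝ) (N : ℕ)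
    (u : ℕ → ℝ) (i : ℕ) : ℝ :=
  if i = 0 ∨ i = N then -u i
  else
    let h : ℕ → ℝ := fun k => x (k + 1) - x k
    γ / (Acoef β (h (i - 1)) + Acoef β (h i)) *
      (Bcoef β (h (i - 1)) * u (i - 1) -
        (Bcoef β (h (i - 1)) + Bcoef β (h i)) * u i + Bcoef β (h i) * u (i + 1) -
        (f (x (i - 1)) (u (i - 1)) + f (x i) (u i)) * Acoef β (h (i - 1)) / γ -
        (f (x i) (u i) + f (x (i + 1)) (u (i + 1))) * Acoef β (h i) / γ)

theorem Acoef_two_mul (q : ℝ) (hq : 0 < q) {β h : ℝ} (hh : β * h = 2 * q) :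
    Acoef β h = Real.sinh q / Real.cosh q := by
  have hs : 0 < Real.sinh q := Real.sinh_pos_iff.2 hq
  have hc : 0 < Real.cosh q := Real.cosh_pos q
  rw [Acoef, hh, Real.sinh_two_mul, Real.cosh_two_mul, Real.cosh_sq]
  field_simp
  ring

theorem Bcoef_two_mul (q : ℝ) (hq : 0 < q) {β h : ℝ} (hh : β * h = 2 * q) :
    Bcoef β h = Real.cosh q / Real.sinh q := by
  have hs : 0 < Real.sinh q := Real.sinh_pos_iff.2 hq
  have hc : 0 < Real.cosh q := Real.cosh_pos q
  rw [Bcoef, hh, Real.sinh_two_mul, Real.cosh_two_mul, Real.sinh_sq]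
  field_simp
  ring

theorem sinh_le_mul_cosh {q : ℝ} (hq : 0 ≤ q) : Real.sinh q ≤ q * Real.cosh q := by
  have hmono : MonotoneOn (fun t : ℝ => t * Real.cosh t - Real.sinh t) (Set.Ici 0) := by
    have hd : ∀ t : ℝ, HasDerivAt (fun t : ℝ => t * Real.cosh t - Real.sinh t)
        (1 * Real.cosh t + t * Real.sinh t - Real.cosh t) t := fun t =>
      ((hasDerivAt_id t).mul (Real.hasDerivAt_cosh t)).sub (Real.hasDerivAt_sinh t)
    refine monotoneOn_of_deriv_nonneg (convex_Ici 0)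
      (fun t _ => (hd t).continuousAt.continuousWithinAt)
      (fun t _ => (hd t).differentiableAt.differentiableWithinAt) fun t ht => ?_
    rw [interior_Ici] at ht
    have ht' : 0 < t := ht
    rw [(hd t).deriv]
    have := mul_pos ht' (Real.sinh_pos_iff.2 ht')
    linarith
  have := hmono (Set.mem_Ici.2 le_rfl) (Set.mem_Ici.2 hq) hq
  simp at this
  linarith

theorem Acoef_pos {β h : ℝ} (hh : 0 < β * h) : 0 < Acoef β h := by
  rw [Acoef_two_mul (β * h / 2) (by linarith) (by ring)]
  exact div_pos (Real.sinh_pos_iff.2 (by linarith)) (Real.cosh_pos _)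

theorem Acoef_le_one {β h : ℝ} (hh : 0 < β * h) : Acoef β h ≤ 1 := by
  rw [Acoef_two_mul (β * h / 2) (by linarith) (by ring), div_le_one (Real.cosh_pos _)]
  exact (Real.sinh_lt_cosh _).le

theorem Bcoef_mul_Acoef {β h : ℝ} (hh : 0 < β * h) : Bcoef β h * Acoef β h = 1 := by
  rw [Acoef_two_mul (β * h / 2) (by linarith) (by ring),
    Bcoef_two_mul (β * h / 2) (by linarith) (by ring)]
  have hs : 0 < Real.sinh (β * h / 2) := Real.sinh_pos_iff.2 (by linarith)
  have hc : 0 < Real.cosh (β * h / 2) := Real.cosh_pos _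
  field_simp

theorem Acoef_le_half {β h : ℝ} (hh : 0 < β * h) : Acoef β h ≤ β * h / 2 := by
  rw [Acoef_two_mul (β * h / 2) (by linarith) (by ring), div_le_iff₀ (Real.cosh_pos _)]
  exact sinh_le_mul_cosh (by linarith)

theorem div_cosh_le_Acoef {β h c : ℝ} (hh : 0 < β * h) (hc : β * h / 2 ≤ c) :
    β * h / 2 / Real.cosh c ≤ Acoef β h := by
  rw [Acoef_two_mul (β * h / 2) (by linarith) (by ring)]
  have h1 : β * h / 2 ≤ Real.sinh (β * h / 2) := Real.self_le_sinh_iff.2 (by linarith)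
  have h2 : Real.cosh (β * h / 2) ≤ Real.cosh c := by
    rw [Real.cosh_le_cosh, abs_of_pos (by linarith), abs_of_pos (by linarith)]
    exact hc
  exact div_le_div₀ (by linarith) h1 (Real.cosh_pos _) h2

theorem mul_Bcoef_sub_mul_Bcoef_mem {β a b : ℝ} (hβ : 0 < β) (ha : 0 < a) (hab : a ≤ b) :
    0 ≤ b * Bcoef β b - a * Bcoef β a ∧
      b * Bcoef β b - a * Bcoef β a ≤ (b - a) * Acoef β b := by
  obtain ⟨p, hp⟩ : ∃ p, p = β * a / 2 := ⟨_, rfl⟩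
  obtain ⟨c, hc⟩ : ∃ c, c = β * (b - a) / 2 := ⟨_, rfl⟩
  have hp0 : 0 < p := by rw [hp]; positivity
  have hc0 : 0 ≤ c := by rw [hc]; have := sub_nonneg.2 hab; positivity
  have hpc : 0 < p + c := by linarith
  have ea : a = 2 / β * p := by rw [hp]; field_simp
  have eb : b = 2 / β * (p + c) := by rw [hp, hc]; field_simp; ring
  have hba : Bcoef β a = _ := Bcoef_two_mul p hp0 (by rw [hp]; ring)
  have hbb : Bcoef β b = _ := Bcoef_two_mul (p + c) hpc (by rw [hp, hc]; ring)
  have hab' : Acoef β b = _ := Acoef_two_mul (p + c) hpc (by rw [hp, hc]; ring)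
  rw [hba, hbb, hab']
  have hsp : 0 < Real.sinh p := Real.sinh_pos_iff.2 hp0
  have hsb : 0 < Real.sinh (p + c) := Real.sinh_pos_iff.2 hpc
  have hcb : 0 < Real.cosh (p + c) := Real.cosh_pos _
  have hsc : c ≤ Real.sinh c := Real.self_le_sinh_iff.2 hc0
  have hpsp : p ≤ Real.sinh p := Real.self_le_sinh_iff.2 hp0.le
  have hsc' : Real.sinh c ≤ c * Real.cosh (p + c) := by
    refine (sinh_le_mul_cosh hc0).trans (mul_le_mul_of_nonneg_left ?_ hc0)
    rw [Real.cosh_le_cosh, abs_of_nonneg hc0, abs_of_pos hpc]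
    linarith
  have hspc : Real.sinh p ≤ p * Real.cosh p := sinh_le_mul_cosh hp0.le
  have hcc : 1 ≤ Real.cosh c := Real.one_le_cosh c
  have hdiff : Real.sinh (p + c) * Real.cosh p - Real.cosh (p + c) * Real.sinh p
      = Real.sinh c := by
    rw [Real.sinh_add, Real.cosh_add]
    linear_combination Real.sinh c * Real.cosh_sq_sub_sinh_sq p
  have hdiff2 : Real.cosh (p + c) * Real.cosh p - Real.sinh (p + c) * Real.sinh p
      = Real.cosh c := by
    rw [Real.sinh_add, Real.cosh_add]
    linear_combination Real.cosh c * Real.cosh_sq_sub_sinh_sq p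
  have hsq := Real.cosh_sq_sub_sinh_sq (p + c)
  have hβ2 : 0 < 2 / β := by positivity
  constructor
  · rw [ea, eb, mul_assoc, mul_assoc, ← mul_sub]
    refine mul_nonneg hβ2.le ?_
    rw [← mul_div_assoc, ← mul_div_assoc, div_sub_div _ _ hsb.ne' hsp.ne']
    refine div_nonneg ?_ (by positivity)
    have e1 : (p + c) * Real.cosh (p + c) * Real.sinh p - Real.sinh (p + c) * (p * Real.cosh p)
        = c * Real.sinh p * Real.cosh (p + c) - p * Real.sinh c := by
      rw [← hdiff]; ring
    rw [e1]
    have := mul_le_mul_of_nonneg_left hsc' hp0.le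
    have := mul_le_mul_of_nonneg_right hpsp (mul_nonneg hc0 hcb.le)
    nlinarith
  · have : 2 / β * (p + c) * (Real.cosh (p + c) / Real.sinh (p + c)) -
        2 / β * p * (Real.cosh p / Real.sinh p) -
        (2 / β * (p + c) - 2 / β * p) * (Real.sinh (p + c) / Real.cosh (p + c)) =
        2 / β * (((p + c) * Real.sinh p - p * Real.cosh c * Real.sinh (p + c)) /
          (Real.sinh (p + c) * Real.cosh (p + c) * Real.sinh p)) := by
      rw [← hdiff2]
      field_simp
      linear_combination (p + c) * Real.sinh p * hsq
    rw [← ea, ← eb] at this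
    have h2 : (p + c) * Real.sinh p ≤ p * Real.cosh c * Real.sinh (p + c) := by
      have h3 : (p + c) * Real.sinh p ≤ p * Real.sinh (p + c) := by
        rw [Real.sinh_add]
        have := mul_le_mul_of_nonneg_left hcc (mul_nonneg hp0.le hsp.le)
        have := mul_le_mul_of_nonneg_left hsc (mul_nonneg hp0.le (Real.cosh_pos p).le)
        have := mul_le_mul_of_nonneg_right hspc hc0
        nlinarith
      have := mul_le_mul_of_nonneg_left hcc (mul_nonneg hp0.le hsb.le)
      nlinarith
    have h4 : 2 / β * (((p + c) * Real.sinh p - p * Real.cosh c * Real.sinh (p + c)) /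
          (Real.sinh (p + c) * Real.cosh (p + c) * Real.sinh p)) ≤ 0 :=
      mul_nonpos_of_nonneg_of_nonpos hβ2.le
        (div_nonpos_of_nonpos_of_nonneg (by linarith) (by positivity))
    linarith

theorem abs_mul_Bcoef_sub_le {β a b : ℝ} (hβ : 0 < β) (ha : 0 < a) (hb : 0 < b) :
    |b * Bcoef β b - a * Bcoef β a| ≤ |b - a| * (Acoef β a + Acoef β b) := by
  have hA := Acoef_pos (mul_pos hβ ha)
  have hB := Acoef_pos (mul_pos hβ hb)
  rcases le_total a b with h | h
  · obtain ⟨h1, h2⟩ := mul_Bcoef_sub_mul_Bcoef_mem hβ ha h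
    rw [abs_of_nonneg h1, abs_of_nonneg (by linarith)]
    nlinarith [sub_nonneg.2 h]
  · obtain ⟨h1, h2⟩ := mul_Bcoef_sub_mul_Bcoef_mem hβ hb h
    rw [abs_sub_comm, abs_sub_comm b a, abs_of_nonneg h1, abs_of_nonneg (by linarith)]
    nlinarith [sub_nonneg.2 h]

/-- The three-point linear operator with coefficients `A`, `B` and reaction term `d`, at the
interior node `i + 1`. -/
def linOp (A B d u : ℕ → ℝ) (i : ℕ) : ℝ :=
  (B i - A i * d i) * u i - (B i + B (i + 1) + (A i + A (i + 1)) * d (i + 1)) * u (i + 1) +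
    (B (i + 1) - A (i + 1) * d (i + 2)) * u (i + 2)

theorem nonneg_of_linOp_nonpos {N : ℕ} {A B d w : ℕ → ℝ} (hA : ∀ i < N, 0 < A i)
    (hAB : ∀ i < N, A i ≤ B i) (hd : ∀ i, 0 < d i) (hd1 : ∀ i, d i ≤ 1)
    (h0 : 0 ≤ w 0) (hN : 0 ≤ w N) (hw : ∀ i, i + 1 < N → linOp A B d w i ≤ 0) :
    ∀ i ≤ N, 0 ≤ w i := by
  obtain ⟨j, hj, hmin⟩ := Finset.exists_min_image (Finset.range (N + 1)) w ⟨0, by simp⟩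
  have hmin' : ∀ i ≤ N, w j ≤ w i := fun i hi => hmin i (by simp; omega)
  have hjN : j ≤ N := by simp at hj; omega
  suffices 0 ≤ w j from fun i hi => this.trans (hmin' i hi)
  by_contra! hneg
  have hj0 : j ≠ 0 := by rintro rfl; linarith
  have hjN' : j ≠ N := by rintro rfl; linarith
  obtain ⟨i, rfl⟩ := Nat.exists_eq_succ_of_ne_zero hj0
  have hi : i + 1 < N := lt_of_le_of_ne hjN hjN'
  have h := hw i hi
  simp only [Nat.succ_eq_add_one] at *
  unfold linOp at h
  have a1 := hA i (by omega)
  have a2 := hA (i + 1) hi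
  have b1 := hAB i (by omega)
  have b2 := hAB (i + 1) hi
  have p1 : 0 ≤ B i - A i * d i := by nlinarith [hd1 i]
  have p2 : 0 ≤ B (i + 1) - A (i + 1) * d (i + 2) := by nlinarith [hd1 (i + 2)]
  have q1 := mul_le_mul_of_nonneg_left (hmin' i (by omega)) p1
  have q2 := mul_le_mul_of_nonneg_left (hmin' (i + 2) (by omega)) p2
  have r1 := mul_pos a1 (hd i)
  have r2 := mul_pos (add_pos a1 a2) (hd (i + 1))
  have r3 := mul_pos a2 (hd (i + 2))
  nlinarith

theorem abs_le_of_linOp_le {N : ℕ} {A B d e U : ℕ → ℝ} (hA : ∀ i < N, 0 < A i)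
    (hAB : ∀ i < N, A i ≤ B i) (hd : ∀ i, 0 < d i) (hd1 : ∀ i, d i ≤ 1)
    (e0 : e 0 = 0) (eN : e N = 0) (U0 : 0 ≤ U 0) (UN : 0 ≤ U N)
    (h : ∀ i, i + 1 < N → linOp A B d U i ≤ -|linOp A B d e i|) :
    ∀ i ≤ N, |e i| ≤ U i := by
  intro i hi
  have h1 := nonneg_of_linOp_nonpos (w := fun i => U i - e i) hA hAB hd hd1
    (by simp [e0, U0]) (by simp [eN, UN]) (fun i hi => by
      have e1 : linOp A B d (fun i => U i - e i) i = linOp A B d U i - linOp A B d e i := by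
        simp only [linOp]; ring
      rw [e1]
      linarith [h i hi, neg_le_abs (linOp A B d e i)]) i hi
  have h2 := nonneg_of_linOp_nonpos (w := fun i => U i + e i) hA hAB hd hd1
    (by simp [e0, U0]) (by simp [eN, UN]) (fun i hi => by
      have e1 : linOp A B d (fun i => U i + e i) i = linOp A B d U i + linOp A B d e i := by
        simp only [linOp]; ring
      rw [e1]
      linarith [h i hi, le_abs_self (linOp A B d e i)]) i hi
  rw [abs_le]
  constructor <;> linarith

/-- The discrete boundary layer function attached to the left end point. -/
def leftBarrier (κ : ℝ) (A : ℕ → ℝ) (i : ℕ) : ℝ := ∏ j ∈ Finset.range i, (1 - κ * A j)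

/-- The discrete boundary layer function attached to the right end point. -/
def rightBarrier (κ : ℝ) (A : ℕ → ℝ) (N i : ℕ) : ℝ := ∏ j ∈ Finset.Ico i N, (1 - κ * A j)

theorem leftBarrier_nonneg {N : ℕ} {A : ℕ → ℝ} {κ : ℝ} (h : ∀ i < N, κ * A i ≤ 1)
    {i : ℕ} (hi : i ≤ N) : 0 ≤ leftBarrier κ A i :=
  Finset.prod_nonneg fun j hj => sub_nonneg.2 (h j (by simp at hj; omega))

theorem rightBarrier_nonneg {N : ℕ} {A : ℕ → ℝ} {κ : ℝ} (h : ∀ i < N, κ * A i ≤ 1)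
    {i : ℕ} : 0 ≤ rightBarrier κ A N i :=
  Finset.prod_nonneg fun j hj => sub_nonneg.2 (h j (by simp at hj; omega))

theorem leftBarrier_succ (κ : ℝ) (A : ℕ → ℝ) (i : ℕ) :
    leftBarrier κ A (i + 1) = leftBarrier κ A i * (1 - κ * A i) :=
  Finset.prod_range_succ _ _

theorem rightBarrier_eq (κ : ℝ) (A : ℕ → ℝ) {N i : ℕ} (hi : i < N) :
    rightBarrier κ A N i = (1 - κ * A i) * rightBarrier κ A N (i + 1) :=
  Finset.prod_eq_prod_Ico_succ_bot hi _

theorem linOp_leftBarrier_le {N : ℕ} {A B d : ℕ → ℝ} {κ μ : ℝ} (hA : ∀ i < N, 0 < A i)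
    (hA1 : ∀ i < N, κ * A i ≤ 1) (hBA : ∀ i < N, B i * A i = 1) (hd : ∀ i, μ ≤ d i)
    (hμ : 0 ≤ μ) (hκ : κ ^ 2 ≤ μ) {i : ℕ} (hi : i + 1 < N) :
    linOp A B d (leftBarrier κ A) i ≤ -(μ * (A i + A (i + 1)) * leftBarrier κ A (i + 1)) := by
  have s0 := leftBarrier_nonneg hA1 (i := i) (by omega)
  have s1 := leftBarrier_nonneg hA1 (i := i + 1) (by omega)
  have s2 := leftBarrier_nonneg hA1 (i := i + 2) (by omega)
  have a1 := hA i (by omega)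
  have a2 := hA (i + 1) hi
  have t1 : B i * (leftBarrier κ A i - leftBarrier κ A (i + 1)) = κ * leftBarrier κ A i := by
    rw [leftBarrier_succ]
    linear_combination κ * leftBarrier κ A i * hBA i (by omega)
  have t2 : B (i + 1) * (leftBarrier κ A (i + 1) - leftBarrier κ A (i + 2)) =
      κ * leftBarrier κ A (i + 1) := by
    rw [leftBarrier_succ κ A (i + 1)]
    linear_combination κ * leftBarrier κ A (i + 1) * hBA (i + 1) hi
  have t3 : κ * leftBarrier κ A i - κ * leftBarrier κ A (i + 1) =
      κ ^ 2 * (A i * leftBarrier κ A i) := by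
    rw [leftBarrier_succ]; ring
  have u1 := mul_le_mul_of_nonneg_right (hκ.trans (hd i)) (mul_nonneg a1.le s0)
  have u2 := mul_le_mul_of_nonneg_right (hd (i + 1)) (mul_nonneg (add_pos a1 a2).le s1)
  have u3 := mul_nonneg (hμ.trans (hd (i + 2))) (mul_nonneg a2.le s2)
  unfold linOp
  linarith

theorem linOp_rightBarrier_le {N : ℕ} {A B d : ℕ → ℝ} {κ μ : ℝ} (hA : ∀ i < N, 0 < A i)
    (hA1 : ∀ i < N, κ * A i ≤ 1) (hBA : ∀ i < N, B i * A i = 1) (hd : ∀ i, μ ≤ d i)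
    (hμ : 0 ≤ μ) (hκ : κ ^ 2 ≤ μ) {i : ℕ} (hi : i + 1 < N) :
    linOp A B d (rightBarrier κ A N) i ≤
      -(μ * (A i + A (i + 1)) * rightBarrier κ A N (i + 1)) := by
  have s0 := rightBarrier_nonneg hA1 (i := i)
  have s1 := rightBarrier_nonneg hA1 (i := i + 1)
  have s2 := rightBarrier_nonneg hA1 (i := i + 2)
  have a1 := hA i (by omega)
  have a2 := hA (i + 1) hi
  have e1 := rightBarrier_eq κ A (show i < N by omega)
  have e2 := rightBarrier_eq κ A hi
  have t1 : B i * (rightBarrier κ A N (i + 1) - rightBarrier κ A N i) =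
      κ * rightBarrier κ A N (i + 1) := by
    rw [e1]
    linear_combination κ * rightBarrier κ A N (i + 1) * hBA i (by omega)
  have t2 : B (i + 1) * (rightBarrier κ A N (i + 2) - rightBarrier κ A N (i + 1)) =
      κ * rightBarrier κ A N (i + 2) := by
    rw [e2]
    linear_combination κ * rightBarrier κ A N (i + 2) * hBA (i + 1) hi
  have t3 : κ * rightBarrier κ A N (i + 2) - κ * rightBarrier κ A N (i + 1) =
      κ ^ 2 * (A (i + 1) * rightBarrier κ A N (i + 2)) := by
    rw [e2]; ring
  have u1 := mul_le_mul_of_nonneg_right (hκ.trans (hd (i + 2))) (mul_nonneg a2.le s2)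
  have u2 := mul_le_mul_of_nonneg_right (hd (i + 1)) (mul_nonneg (add_pos a1 a2).le s1)
  have u3 := mul_nonneg (hμ.trans (hd i)) (mul_nonneg a1.le s0)
  unfold linOp
  linarith

theorem abs_le_barrier {N : ℕ} {A B d e : ℕ → ℝ} {κ μ c₁ c₂ : ℝ} (hA : ∀ i < N, 0 < A i)
    (hA1 : ∀ i < N, A i ≤ 1) (hBA : ∀ i < N, B i * A i = 1) (hd : ∀ i, μ ≤ d i)
    (hd1 : ∀ i, d i ≤ 1) (hμ : 0 < μ) (hκ0 : 0 ≤ κ) (hκ1 : κ ≤ 1) (hκ : κ ^ 2 ≤ μ)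
    (hc₁ : 0 ≤ c₁) (hc₂ : 0 ≤ c₂) (e0 : e 0 = 0) (eN : e N = 0)
    (h : ∀ i, i + 1 < N → |linOp A B d e i| ≤ μ * (A i + A (i + 1)) *
      (c₁ + c₂ * (leftBarrier κ A (i + 1) + rightBarrier κ A N (i + 1)))) :
    ∀ i ≤ N, |e i| ≤ c₁ + c₂ * (leftBarrier κ A i + rightBarrier κ A N i) := by
  have hκA : ∀ i < N, κ * A i ≤ 1 := fun i hi => by nlinarith [hA i hi, hA1 i hi]
  have hAB : ∀ i < N, A i ≤ B i := fun i hi => by nlinarith [hA i hi, hA1 i hi, hBA i hi]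
  have hU : ∀ i ≤ N, 0 ≤ c₁ + c₂ * (leftBarrier κ A i + rightBarrier κ A N i) := fun i hi =>
    add_nonneg hc₁ (mul_nonneg hc₂ (add_nonneg (leftBarrier_nonneg hκA hi)
      (rightBarrier_nonneg hκA)))
  refine abs_le_of_linOp_le hA hAB (fun i => hμ.trans_le (hd i)) hd1 e0 eN
    (hU 0 (Nat.zero_le _)) (hU N le_rfl) fun i hi => ?_
  have l1 := mul_le_mul_of_nonneg_left
    (linOp_leftBarrier_le hA hκA hBA hd hμ.le hκ hi) hc₂
  have l2 := mul_le_mul_of_nonneg_left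
    (linOp_rightBarrier_le hA hκA hBA hd hμ.le hκ hi) hc₂
  have e1 : linOp A B d (fun i => c₁ + c₂ * (leftBarrier κ A i + rightBarrier κ A N i)) i =
      -(c₁ * (A i * d i + (A i + A (i + 1)) * d (i + 1) + A (i + 1) * d (i + 2))) +
      c₂ * linOp A B d (leftBarrier κ A) i + c₂ * linOp A B d (rightBarrier κ A N) i := by
    simp only [linOp]; ring
  have a1 := hA i (by omega)
  have a2 := hA (i + 1) hi
  have u1 := mul_nonneg hc₁ (mul_nonneg a1.le (hμ.le.trans (hd i)))
  have u2 := mul_nonneg hc₁ (mul_nonneg a2.le (hμ.le.trans (hd (i + 2))))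
  have u3 := mul_le_mul_of_nonneg_left
    (mul_le_mul_of_nonneg_left (hd (i + 1)) (add_pos a1 a2).le) hc₁
  rw [e1]
  linarith [h i hi]

theorem rightBarrier_eq_leftBarrier (κ : ℝ) (A : ℕ → ℝ) {N i : ℕ} (hi : i ≤ N) :
    rightBarrier κ A N i = leftBarrier κ (fun j => A (N - 1 - j)) (N - i) := by
  unfold rightBarrier leftBarrier
  rw [Finset.prod_Ico_eq_prod_range, ← Finset.prod_range_reflect]
  refine Finset.prod_congr rfl fun j hj => ?_
  rw [Finset.mem_range] at hj
  rw [show i + (N - i - 1 - j) = N - 1 - j by omega]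

theorem exp_le_leftBarrier {A x : ℕ → ℝ} {κ β : ℝ} {i : ℕ} (hκ0 : 0 ≤ κ) (hκ : κ ≤ 1 / 2)
    (hA : ∀ j < i, 0 ≤ A j) (hA1 : ∀ j < i, A j ≤ 1)
    (hAx : ∀ j < i, A j ≤ β * (x (j + 1) - x j) / 2) :
    Real.exp (-(κ * β * (x i - x 0))) ≤ leftBarrier κ A i := by
  induction i with
  | zero => simp [leftBarrier]
  | succ i ih =>
    have ih' := ih (fun j hj => hA j (by omega)) (fun j hj => hA1 j (by omega))
      (fun j hj => hAx j (by omega))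
    have h0 := hA i (by omega)
    have h1 := hA1 i (by omega)
    have hx := mul_le_mul_of_nonneg_left (hAx i (by omega)) hκ0
    obtain ⟨t, ht⟩ : ∃ t, t = κ * A i := ⟨_, rfl⟩
    have ht0 : 0 ≤ t := by rw [ht]; positivity
    have ht1 : t ≤ 1 / 2 := by rw [ht]; nlinarith
    have hexp : Real.exp (-(2 * t)) ≤ 1 - t := by
      have h2 := Real.quadratic_le_exp_of_nonneg (show 0 ≤ 2 * t by linarith)
      rw [Real.exp_neg, inv_le_comm₀ (Real.exp_pos _) (by linarith), ← one_div,
        div_le_iff₀ (by linarith)]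
      nlinarith [mul_nonneg ht0 ht0]
    rw [leftBarrier_succ, ← ht,
      show -(κ * β * (x (i + 1) - x 0)) = -(κ * β * (x i - x 0)) +
        -(κ * β * (x (i + 1) - x i)) by ring, Real.exp_add]
    refine mul_le_mul ih' (le_trans (Real.exp_le_exp.2 ?_) hexp) (Real.exp_pos _).le
      ((Real.exp_pos _).le.trans ih')
    rw [ht]
    linarith

theorem exp_le_rightBarrier {A x : ℕ → ℝ} {κ β : ℝ} {N i : ℕ} (hκ0 : 0 ≤ κ) (hκ : κ ≤ 1 / 2)
    (hA : ∀ j < N, 0 ≤ A j) (hA1 : ∀ j < N, A j ≤ 1)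
    (hAx : ∀ j < N, A j ≤ β * (x (j + 1) - x j) / 2) (hi : i ≤ N) :
    Real.exp (-(κ * β * (x N - x i))) ≤ rightBarrier κ A N i := by
  rw [rightBarrier_eq_leftBarrier κ A hi]
  have := exp_le_leftBarrier (A := fun j => A (N - 1 - j)) (x := fun j => -x (N - j)) (β := β)
    (i := N - i) hκ0 hκ (fun j hj => hA _ (by omega)) (fun j hj => hA1 _ (by omega))
    (fun j hj => by
      have := hAx (N - 1 - j) (by omega)
      rw [show N - 1 - j + 1 = N - j by omega] at this
      rw [show N - (j + 1) = N - 1 - j by omega]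
      linarith)
  rw [show N - (N - i) = i by omega, Nat.sub_zero] at this
  rwa [show x N - x i = -x i - -x N by ring]

theorem leftBarrier_le_exp {A : ℕ → ℝ} {κ a : ℝ} {n i : ℕ} (hκ0 : 0 ≤ κ)
    (hA : ∀ j < i, 0 ≤ A j) (hA1 : ∀ j < i, κ * A j ≤ 1)
    (ha : ∀ j < n, a ≤ A j) (hi : n ≤ i) :
    leftBarrier κ A i ≤ Real.exp (-(κ * a * n)) := by
  induction i, hi using Nat.le_induction with
  | base =>
    rw [show -(κ * a * n) = n * (-(κ * a)) by ring, Real.exp_nat_mul, ← Finset.card_range n,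
      ← Finset.prod_const, Finset.card_range]
    refine Finset.prod_le_prod (fun j hj => sub_nonneg.2 (hA1 j (Finset.mem_range.1 hj)))
      fun j hj => ?_
    have h1 := Real.add_one_le_exp (-(κ * a))
    have h2 := mul_le_mul_of_nonneg_left (ha j (Finset.mem_range.1 hj)) hκ0
    linarith
  | succ i hi ih =>
    have ih' := ih (fun j hj => hA j (by omega)) (fun j hj => hA1 j (by omega))
    have h0 := leftBarrier_nonneg hA1 (i := i) (by omega)
    have h1 := mul_nonneg hκ0 (hA i (by omega))
    rw [leftBarrier_succ]
    nlinarith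

theorem rightBarrier_le_exp {A : ℕ → ℝ} {κ a : ℝ} {N n i : ℕ} (hκ0 : 0 ≤ κ)
    (hA : ∀ j < N, 0 ≤ A j) (hA1 : ∀ j < N, κ * A j ≤ 1)
    (ha : ∀ j < N, N ≤ j + n → a ≤ A j) (hi : i + n ≤ N) :
    rightBarrier κ A N i ≤ Real.exp (-(κ * a * n)) := by
  rw [rightBarrier_eq_leftBarrier κ A (by omega)]
  exact leftBarrier_le_exp hκ0 (fun j hj => hA _ (by omega)) (fun j hj => hA1 _ (by omega))
    (fun j hj => ha _ (by omega) (by omega)) (by omega)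

theorem flux_right_le {v v1 v2 : ℝ → ℝ} {a b β η : ℝ} (hab : a < b) (hβ : 0 < β)
    (hv : ContinuousOn v (Set.Icc a b)) (hv1 : ContinuousOn v1 (Set.Icc a b))
    (hd : ∀ t ∈ Set.Ioo a b, HasDerivAt v (v1 t) t)
    (hd1 : ∀ t ∈ Set.Ioo a b, HasDerivAt v1 (v2 t) t)
    (hη : ∀ t ∈ Set.Ioo a b, v2 t - β ^ 2 * v t ≤ β ^ 2 * η) :
    v b / Real.sinh (β * (b - a)) -
      v a * (Real.cosh (β * (b - a)) / Real.sinh (β * (b - a))) - v1 a / β ≤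
      η * Acoef β (b - a) := by
  have hS : 0 < Real.sinh (β * (b - a)) :=
    Real.sinh_pos_iff.2 (mul_pos hβ (sub_pos.2 hab))
  have hanti : AntitoneOn (fun s => v1 s * Real.sinh (β * (b - s)) +
      β * v s * Real.cosh (β * (b - s)) + β * η * Real.cosh (β * (b - s)))
      (Set.Icc a b) := by
    have hder : ∀ t ∈ Set.Ioo a b, HasDerivAt (fun s => v1 s * Real.sinh (β * (b - s)) +
        β * v s * Real.cosh (β * (b - s)) + β * η * Real.cosh (β * (b - s)))
        ((v2 t - β ^ 2 * v t - β ^ 2 * η) * Real.sinh (β * (b - t))) t := by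
      intro t ht
      have hl : HasDerivAt (fun s => β * (b - s)) (-β) t := by
        simpa using ((hasDerivAt_id t).const_sub b).const_mul β
      have h1 := (hd1 t ht).mul hl.sinh
      have h2 := ((hd t ht).const_mul β).mul hl.cosh
      have h3 := hl.cosh.const_mul (β * η)
      refine ((h1.add h2).add h3).congr_deriv ?_
      ring
    refine antitoneOn_of_deriv_nonpos (convex_Icc a b) ?_ ?_ ?_
    · fun_prop
    · intro t ht
      rw [interior_Icc] at ht
      exact (hder t ht).differentiableAt.differentiableWithinAt
    · intro t ht
      rw [interior_Icc] at ht
      rw [(hder t ht).deriv]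
      exact mul_nonpos_of_nonpos_of_nonneg (by linarith [hη t ht])
        (Real.sinh_nonneg_iff.2 (mul_nonneg hβ.le (sub_nonneg.2 ht.2.le)))
  have k := hanti (Set.left_mem_Icc.2 hab.le) (Set.right_mem_Icc.2 hab.le) hab.le
  simp only [sub_self, mul_zero, Real.sinh_zero, Real.cosh_zero, mul_one, zero_add] at k
  have e : v b / Real.sinh (β * (b - a)) -
      v a * (Real.cosh (β * (b - a)) / Real.sinh (β * (b - a))) - v1 a / β =
      (β * v b - v1 a * Real.sinh (β * (b - a)) - β * v a * Real.cosh (β * (b - a))) /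
        (β * Real.sinh (β * (b - a))) := by
    field_simp
    ring
  have e2 : η * Acoef β (b - a) = (β * η * (Real.cosh (β * (b - a)) - 1)) /
        (β * Real.sinh (β * (b - a))) := by
    unfold Acoef
    field_simp
  rw [e, e2]
  refine div_le_div_of_nonneg_right ?_ (mul_pos hβ hS).le
  linarith

theorem flux_right {v v1 v2 : ℝ → ℝ} {a b β η : ℝ} (hab : a < b) (hβ : 0 < β)
    (hv : ContinuousOn v (Set.Icc a b)) (hv1 : ContinuousOn v1 (Set.Icc a b))
    (hd : ∀ t ∈ Set.Ioo a b, HasDerivAt v (v1 t) t)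
    (hd1 : ∀ t ∈ Set.Ioo a b, HasDerivAt v1 (v2 t) t)
    (hη : ∀ t ∈ Set.Ioo a b, |v2 t - β ^ 2 * v t| ≤ β ^ 2 * η) :
    |v b / Real.sinh (β * (b - a)) -
      v a * (Real.cosh (β * (b - a)) / Real.sinh (β * (b - a))) - v1 a / β| ≤
      η * Acoef β (b - a) := by
  have h1 := flux_right_le hab hβ hv hv1 hd hd1 fun t ht => (abs_le.1 (hη t ht)).2
  have h2 := flux_right_le (v := fun t => -v t) (v1 := fun t => -v1 t) (v2 := fun t => -v2 t)
    (η := η) hab hβ hv.neg hv1.neg (fun t ht => (hd t ht).neg) (fun t ht => (hd1 t ht).neg)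
    fun t ht => by linarith [(abs_le.1 (hη t ht)).1]
  rw [abs_le]
  refine ⟨?_, h1⟩
  simp only [neg_div, neg_mul] at h2
  linarith

theorem flux_left {v v1 v2 : ℝ → ℝ} {a b β η : ℝ} (hab : a < b) (hβ : 0 < β)
    (hv : ContinuousOn v (Set.Icc a b)) (hv1 : ContinuousOn v1 (Set.Icc a b))
    (hd : ∀ t ∈ Set.Ioo a b, HasDerivAt v (v1 t) t)
    (hd1 : ∀ t ∈ Set.Ioo a b, HasDerivAt v1 (v2 t) t)
    (hη : ∀ t ∈ Set.Ioo a b, |v2 t - β ^ 2 * v t| ≤ β ^ 2 * η) :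
    |v a / Real.sinh (β * (b - a)) -
      v b * (Real.cosh (β * (b - a)) / Real.sinh (β * (b - a))) + v1 b / β| ≤
      η * Acoef β (b - a) := by
  have hmaps : Set.MapsTo (fun s : ℝ => -s) (Set.Icc (-b) (-a)) (Set.Icc a b) := fun s hs => by
    constructor <;> linarith [hs.1, hs.2]
  have hmem : ∀ t ∈ Set.Ioo (-b) (-a), -t ∈ Set.Ioo a b := fun t ht => by
    constructor <;> linarith [ht.1, ht.2]
  have := flux_right (v := fun s => v (-s)) (v1 := fun s => -v1 (-s)) (v2 := fun s => v2 (-s))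
    (β := β) (η := η) (neg_lt_neg hab) hβ (hv.comp continuousOn_neg hmaps)
    (hv1.comp continuousOn_neg hmaps).neg
    (fun t ht => by
      exact ((hd (-t) (hmem t ht)).comp t (hasDerivAt_neg t)).congr_deriv (by ring))
    (fun t ht => by
      exact ((hd1 (-t) (hmem t ht)).comp t (hasDerivAt_neg t)).neg.congr_deriv (by ring))
    (fun t ht => hη (-t) (hmem t ht))
  simp only [neg_neg] at this
  rw [show -a - -b = b - a by ring, neg_div, sub_neg_eq_add] at this
  exact this

theorem local_truncation {y y1 y2 F : ℝ → ℝ} {x₀ x₁ x₂ ε γ β c D δ : ℝ} (h01 : x₀ < x₁)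
    (h12 : x₁ < x₂) (hε : 0 < ε) (hγ : 0 < γ) (hβ : β = Real.sqrt γ / ε)
    (hy : ContinuousOn y (Set.Icc x₀ x₂)) (hy1 : ContinuousOn y1 (Set.Icc x₀ x₂))
    (hd : ∀ t ∈ Set.Ioo x₀ x₂, HasDerivAt y (y1 t) t)
    (hd1 : ∀ t ∈ Set.Ioo x₀ x₂, HasDerivAt y1 (y2 t) t)
    (hode : ∀ t ∈ Set.Ioo x₀ x₂, ε ^ 2 * y2 t = F t)
    (hδ : ∀ t ∈ Set.Icc x₀ x₂, |F t - γ * y t - (c + D * (t - x₁))| ≤ δ) :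
    |Bcoef β (x₁ - x₀) * y x₀ - (Bcoef β (x₁ - x₀) + Bcoef β (x₂ - x₁)) * y x₁ +
        Bcoef β (x₂ - x₁) * y x₂ - (F x₀ + F x₁) * Acoef β (x₁ - x₀) / γ -
        (F x₁ + F x₂) * Acoef β (x₂ - x₁) / γ| ≤
      (Acoef β (x₁ - x₀) + Acoef β (x₂ - x₁)) *
        ((4 * δ + |D| * |(x₂ - x₁) - (x₁ - x₀)|) / γ) := by
  have hβ0 : 0 < β := by rw [hβ]; positivity
  have hβ2 : ε ^ 2 * β ^ 2 = γ := by
    rw [hβ, div_pow, Real.sq_sqrt hγ.le]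
    field_simp
  have cont : ∀ {a b : ℝ}, x₀ ≤ a → b ≤ x₂ →
      ContinuousOn (fun t => y t + (c + D * (t - x₁)) / γ) (Set.Icc a b) ∧
      ContinuousOn (fun t => y1 t + D / γ) (Set.Icc a b) := by
    intro a b ha hb
    have h1 := hy.mono (Set.Icc_subset_Icc ha hb)
    have h2 := hy1.mono (Set.Icc_subset_Icc ha hb)
    constructor <;> fun_prop
  have der : ∀ t ∈ Set.Ioo x₀ x₂,
      HasDerivAt (fun t => y t + (c + D * (t - x₁)) / γ) (y1 t + D / γ) t := by
    intro t ht
    refine (hd t ht).add ?_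
    simpa using ((((hasDerivAt_id t).sub_const x₁).const_mul D).const_add c).div_const γ
  have bd : ∀ t ∈ Set.Ioo x₀ x₂,
      |y2 t - β ^ 2 * (y t + (c + D * (t - x₁)) / γ)| ≤ β ^ 2 * (δ / γ) := by
    intro t ht
    have e : y2 t - β ^ 2 * (y t + (c + D * (t - x₁)) / γ) =
        (F t - γ * y t - (c + D * (t - x₁))) / ε ^ 2 := by
      rw [← hode t ht, ← hβ2]
      field_simp
      ring
    rw [e, abs_div, abs_of_pos (by positivity : (0 : ℝ) < ε ^ 2)]
    have e2 : β ^ 2 * (δ / γ) = δ / ε ^ 2 := by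
      rw [← hβ2]
      field_simp
    rw [e2]
    exact div_le_div_of_nonneg_right (hδ t ⟨ht.1.le, ht.2.le⟩) (by positivity)
  have hl := flux_left h01 hβ0 (cont le_rfl h12.le).1 (cont le_rfl h12.le).2
    (fun t ht => der t ⟨ht.1, ht.2.trans h12⟩)
    (fun t ht => (hd1 t ⟨ht.1, ht.2.trans h12⟩).add_const (D / γ))
    (fun t ht => bd t ⟨ht.1, ht.2.trans h12⟩)
  have hr := flux_right h12 hβ0 (cont h01.le le_rfl).1 (cont h01.le le_rfl).2
    (fun t ht => der t ⟨h01.trans ht.1, ht.2⟩)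
    (fun t ht => (hd1 t ⟨h01.trans ht.1, ht.2⟩).add_const (D / γ))
    (fun t ht => bd t ⟨h01.trans ht.1, ht.2⟩)
  have r0 := hδ x₀ ⟨le_rfl, (h01.trans h12).le⟩
  have r1 := hδ x₁ ⟨h01.le, h12.le⟩
  have r2 := hδ x₂ ⟨(h01.trans h12).le, le_rfl⟩
  have hB := abs_mul_Bcoef_sub_le hβ0 (sub_pos.2 h01) (sub_pos.2 h12)
  have a0 := Acoef_pos (mul_pos hβ0 (sub_pos.2 h01))
  have a1 := Acoef_pos (mul_pos hβ0 (sub_pos.2 h12))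
  have sum_split : ∀ h : ℝ, Acoef β h =
      Real.cosh (β * h) / Real.sinh (β * h) - 1 / Real.sinh (β * h) ∧
      Bcoef β h = Real.cosh (β * h) / Real.sinh (β * h) + 1 / Real.sinh (β * h) := fun h =>
    ⟨by rw [Acoef, sub_div], by rw [Bcoef, add_div]⟩
  obtain ⟨eA0, eB0⟩ := sum_split (x₁ - x₀)
  obtain ⟨eA1, eB1⟩ := sum_split (x₂ - x₁)
  generalize Acoef β (x₁ - x₀) = A0 at *
  generalize Acoef β (x₂ - x₁) = A1 at *
  generalize Bcoef β (x₁ - x₀) = B0 at *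
  generalize Bcoef β (x₂ - x₁) = B1 at *
  rw [div_eq_mul_one_div _ (Real.sinh _)] at hl hr
  generalize Real.cosh (β * (x₁ - x₀)) / Real.sinh (β * (x₁ - x₀)) = k0 at *
  generalize Real.cosh (β * (x₂ - x₁)) / Real.sinh (β * (x₂ - x₁)) = k1 at *
  generalize 1 / Real.sinh (β * (x₁ - x₀)) = s0 at *
  generalize 1 / Real.sinh (β * (x₂ - x₁)) = s1 at *
  have ident : B0 * y x₀ - (B0 + B1) * y x₁ + B1 * y x₂ - (F x₀ + F x₁) * A0 / γ -
      (F x₁ + F x₂) * A1 / γ =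
      2 * (((y x₀ + (c + D * (x₀ - x₁)) / γ) * s0 - (y x₁ + (c + D * (x₁ - x₁)) / γ) * k0 +
          (y1 x₁ + D / γ) / β) +
        ((y x₂ + (c + D * (x₂ - x₁)) / γ) * s1 - (y x₁ + (c + D * (x₁ - x₁)) / γ) * k1 -
          (y1 x₁ + D / γ) / β)) -
      A0 / γ * ((F x₀ - γ * y x₀ - (c + D * (x₀ - x₁))) +
        (F x₁ - γ * y x₁ - (c + D * (x₁ - x₁)))) -
      A1 / γ * ((F x₁ - γ * y x₁ - (c + D * (x₁ - x₁))) +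
        (F x₂ - γ * y x₂ - (c + D * (x₂ - x₁)))) -
      D / γ * ((x₂ - x₁) * B1 - (x₁ - x₀) * B0) := by
    rw [eA0, eA1, eB0, eB1]
    field_simp
    ring
  rw [ident]
  have t1 := mul_le_mul_of_nonneg_left ((abs_add_le _ _).trans (add_le_add r0 r1))
    (div_pos a0 hγ).le
  have t2 := mul_le_mul_of_nonneg_left ((abs_add_le _ _).trans (add_le_add r1 r2))
    (div_pos a1 hγ).le
  have t3 := mul_le_mul_of_nonneg_left hB (div_nonneg (abs_nonneg D) hγ.le)
  rw [← abs_of_pos (div_pos a0 hγ), ← abs_mul, abs_of_pos (div_pos a0 hγ)] at t1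
  rw [← abs_of_pos (div_pos a1 hγ), ← abs_mul, abs_of_pos (div_pos a1 hγ)] at t2
  have t3' : |D / γ * ((x₂ - x₁) * B1 - (x₁ - x₀) * B0)| ≤
      |D| / γ * (|x₂ - x₁ - (x₁ - x₀)| * (A0 + A1)) := by
    rw [abs_mul, abs_div, abs_of_pos hγ]
    exact t3
  have t4 := (abs_add_le _ _).trans (add_le_add hl hr)
  refine (abs_sub _ _).trans ((add_le_add ((abs_sub _ _).trans (add_le_add
    ((abs_sub _ _).trans (add_le_add ?_ t1)) t2)) t3').trans
    (b := 2 * (δ / γ * A0 + δ / γ * A1) + A0 / γ * (δ + δ) + A1 / γ * (δ + δ) +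
      |D| / γ * (|x₂ - x₁ - (x₁ - x₀)| * (A0 + A1))) (le_of_eq ?_))
  · rw [abs_mul, abs_two]
    exact mul_le_mul_of_nonneg_left t4 zero_le_two
  · field_simp
    ring

theorem exists_taylor_bound {f : ℝ → ℝ → ℝ} {k : ℕ} (hk : 2 ≤ k)
    (hf : ContDiffOn ℝ k (Function.uncurry f) (Set.Icc 0 1 ×ˢ Set.univ)) (R : ℝ) :
    ∃ L ≥ (0 : ℝ), ∃ fx : ℝ → ℝ → ℝ, ∀ a ∈ Set.Icc (0 : ℝ) 1, ∀ u ∈ Set.Icc (-R) R,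
      |fx a u| ≤ L ∧ ∀ b ∈ Set.Icc (0 : ℝ) 1, ∀ v ∈ Set.Icc (-R) R,
        |f b v - f a u - fx a u * (b - a) - deriv (f a) u * (v - u)| ≤
          L * ((b - a) ^ 2 + (v - u) ^ 2) := by
  set S : Set (ℝ × ℝ) := Set.Icc 0 1 ×ˢ Set.univ
  set K : Set (ℝ × ℝ) := Set.Icc 0 1 ×ˢ Set.Icc (-R) R
  have hKS : K ⊆ S := Set.prod_mono le_rfl (Set.subset_univ _)
  have hKc : IsCompact K := isCompact_Icc.prod isCompact_Icc
  have hKconv : Convex ℝ K := (convex_Icc 0 1).prod (convex_Icc _ _)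
  have hSu : UniqueDiffOn ℝ S := (uniqueDiffOn_Icc zero_lt_one).prod uniqueDiffOn_univ
  have hf2 : ContDiffOn ℝ 2 (Function.uncurry f) S := hf.of_le (by exact_mod_cast hk)
  have hΦ : ContDiffOn ℝ 1 (fderivWithin ℝ (Function.uncurry f) S) S :=
    hf2.fderivWithin hSu (by norm_num)
  have hd : ∀ p ∈ S, HasFDerivWithinAt (Function.uncurry f)
      (fderivWithin ℝ (Function.uncurry f) S p) S p := fun p hp =>
    (hf2.differentiableOn (by norm_num) p hp).hasFDerivWithinAt
  obtain ⟨C, hC⟩ := (hΦ.mono hKS).exists_lipschitzOnWith (by norm_num) hKconv hKc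
  obtain ⟨M, hM⟩ := hKc.exists_bound_of_continuousOn (hΦ.continuousOn.mono hKS)
  refine ⟨max C M, le_max_of_le_left C.2,
    fun a u => fderivWithin ℝ (Function.uncurry f) S (a, u) (1, 0), fun a ha u hu => ?_⟩
  have hp : (a, u) ∈ K := ⟨ha, hu⟩
  constructor
  · refine le_trans ?_ (le_max_right _ _)
    have h1 := (fderivWithin ℝ (Function.uncurry f) S (a, u)).le_of_opNorm_le (hM _ hp) (1, 0)
    simpa [Prod.norm_def] using h1
  intro b hb v hv
  have hq : (b, v) ∈ K := ⟨hb, hv⟩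
  have hderiv : deriv (f a) u = fderivWithin ℝ (Function.uncurry f) S (a, u) (0, 1) := by
    have hline : HasDerivWithinAt (fun t : ℝ => (a, t)) ((0 : ℝ), (1 : ℝ)) Set.univ u :=
      (hasDerivWithinAt_const u _ a).prodMk (hasDerivWithinAt_id u _)
    have := (hd (a, u) (hKS hp)).comp_hasDerivWithinAt u hline
      (fun t _ => ⟨ha, Set.mem_univ _⟩)
    exact (hasDerivWithinAt_univ.1 this).deriv
  have hball : Convex ℝ (K ∩ Metric.closedBall (a, u) ‖(b, v) - (a, u)‖) :=
    hKconv.inter (convex_closedBall _ _)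
  have key := hball.norm_image_sub_le_of_norm_hasFDerivWithin_le'
    (φ := fderivWithin ℝ (Function.uncurry f) S (a, u)) (C := C * ‖(b, v) - (a, u)‖)
    (fun p hp' => (hd p (hKS hp'.1)).mono (Set.inter_subset_left.trans hKS))
    (fun p hp' => by
      have h1 := hC.norm_sub_le hp'.1 hp
      exact h1.trans (mul_le_mul_of_nonneg_left (by simpa [dist_eq_norm] using hp'.2) C.2))
    (x := (a, u)) (y := (b, v)) ⟨hp, by simp⟩ ⟨hq, by simp [dist_eq_norm]⟩
  have hlin : fderivWithin ℝ (Function.uncurry f) S (a, u) ((b, v) - (a, u)) =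
      fderivWithin ℝ (Function.uncurry f) S (a, u) (1, 0) * (b - a) +
      fderivWithin ℝ (Function.uncurry f) S (a, u) (0, 1) * (v - u) := by
    have : ((b, v) - (a, u) : ℝ × ℝ) = (b - a) • ((1 : ℝ), (0 : ℝ)) +
        (v - u) • ((0 : ℝ), (1 : ℝ)) := by
      simp
    rw [this, map_add, map_smul, map_smul]
    simp [mul_comm]
  have hnorm : ‖(b, v) - (a, u)‖ * ‖(b, v) - (a, u)‖ ≤ (b - a) ^ 2 + (v - u) ^ 2 := by
    rw [Prod.norm_def]
    simp only [Prod.fst_sub, Prod.snd_sub, Real.norm_eq_abs]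
    rcases max_cases |b - a| |v - u| with ⟨h, _⟩ | ⟨h, _⟩ <;> rw [h, abs_mul_abs_self] <;>
      nlinarith [sq_nonneg (b - a), sq_nonneg (v - u)]
  rw [hlin, Real.norm_eq_abs] at key
  rw [hderiv, sub_sub (f b v - f a u)]
  refine key.trans ?_
  rw [mul_assoc]
  exact mul_le_mul (le_max_left _ _) hnorm (by positivity) (le_max_of_le_left C.2)

theorem slope_bounds {φ : ℝ → ℝ} {m γ : ℝ} (hm : 0 < m) (h1 : ∀ u, m ≤ deriv φ u)
    (h2 : ∀ u, deriv φ u ≤ γ) {v u : ℝ} (h : v ≤ u) :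
    m * (u - v) ≤ φ u - φ v ∧ φ u - φ v ≤ γ * (u - v) := by
  have hd : Differentiable ℝ φ := fun u =>
    differentiableAt_of_deriv_ne_zero (hm.trans_le (h1 u)).ne'
  exact ⟨mul_sub_le_image_sub_of_le_deriv hd h1 h,
    image_sub_le_mul_sub_of_deriv_le hd h2 h⟩

theorem exists_slope {φ : ℝ → ℝ} {m γ : ℝ} (hm : 0 < m) (h1 : ∀ u, m ≤ deriv φ u)
    (h2 : ∀ u, deriv φ u ≤ γ) (u v : ℝ) :
    ∃ d, m ≤ d ∧ d ≤ γ ∧ φ u - φ v = d * (u - v) := by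
  rcases lt_trichotomy u v with h | rfl | h
  · obtain ⟨a, b⟩ := slope_bounds hm h1 h2 h.le
    have h' := sub_pos.2 h
    refine ⟨(φ v - φ u) / (v - u), (le_div_iff₀ h').2 a, (div_le_iff₀ h').2 b, ?_⟩
    field_simp
    ring
  · exact ⟨m, le_rfl, (h1 0).trans (h2 0), by simp⟩
  · obtain ⟨a, b⟩ := slope_bounds hm h1 h2 h.le
    have h' := sub_pos.2 h
    refine ⟨(φ u - φ v) / (u - v), (le_div_iff₀ h').2 a, (div_le_iff₀ h').2 b, ?_⟩
    field_simp

theorem exists_reduced_solution {f : ℝ → ℝ → ℝ} {m γ : ℝ} {k : ℕ} (hm : 0 < m) (hk : 2 ≤ k)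
    (hf : ContDiffOn ℝ k (Function.uncurry f) (Set.Icc 0 1 ×ˢ Set.univ))
    (hfy : ∀ a ∈ Set.Icc (0:ℝ) 1, ∀ u : ℝ, m ≤ deriv (f a) u)
    (hγ : ∀ a ∈ Set.Icc (0:ℝ) 1, ∀ u : ℝ, deriv (f a) u ≤ γ) :
    ∃ L ≥ (0 : ℝ), ∃ g G : ℝ → ℝ, ∀ a ∈ Set.Icc (0 : ℝ) 1,
      f a (g a) = 0 ∧ |g a| ≤ L ∧ |G a| ≤ L ∧
      ∀ b ∈ Set.Icc (0 : ℝ) 1, |g b - g a - G a * (b - a)| ≤ L * (b - a) ^ 2 := by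
  have hcont : ContinuousOn (fun a => f a 0) (Set.Icc 0 1) :=
    hf.continuousOn.comp (f := fun a : ℝ => (a, (0 : ℝ))) (by fun_prop)
      (fun a ha => ⟨ha, Set.mem_univ _⟩)
  obtain ⟨M0, hM0⟩ := isCompact_Icc.exists_bound_of_continuousOn hcont
  have hM0' : 0 ≤ M0 := (norm_nonneg _).trans (hM0 0 (by simp))
  set M := M0 / m with hM
  have hMnn : 0 ≤ M := by positivity
  have hex : ∀ a, ∃ u, a ∈ Set.Icc (0 : ℝ) 1 → f a u = 0 ∧ u ∈ Set.Icc (-M) M := by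
    intro a
    by_cases ha : a ∈ Set.Icc (0 : ℝ) 1
    · have hd : Differentiable ℝ (f a) := fun u =>
        differentiableAt_of_deriv_ne_zero (hm.trans_le (hfy a ha u)).ne'
      have h0 := abs_le.1 (hM0 a ha)
      have hmM : m * M = M0 := by rw [hM]; field_simp
      have s1 := (slope_bounds hm (hfy a ha) (hγ a ha) hMnn).1
      have s2 := (slope_bounds hm (hfy a ha) (hγ a ha) (neg_nonpos.2 hMnn)).1
      obtain ⟨u, hu, hu0⟩ := intermediate_value_Icc (by linarith : -M ≤ M)
        hd.continuous.continuousOn (show (0 : ℝ) ∈ Set.Icc (f a (-M)) (f a M) by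
          constructor <;> linarith)
      exact ⟨u, fun _ => ⟨hu0, hu⟩⟩
    · exact ⟨0, fun h => absurd h ha⟩
  choose g hg using hex
  obtain ⟨L, hL, fx, hT⟩ := exists_taylor_bound hk hf M
  set K := 2 * L / m with hK
  have hKnn : 0 ≤ K := by positivity
  have hlip : ∀ a ∈ Set.Icc (0 : ℝ) 1, ∀ b ∈ Set.Icc (0 : ℝ) 1, |g b - g a| ≤ K * |b - a| := by
    intro a ha b hb
    obtain ⟨d, hd1, hd2, hd⟩ := exists_slope hm (hfy b hb) (hγ b hb) (g b) (g a)
    obtain ⟨t1, t2⟩ := hT a ha (g a) (hg a ha).2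
    have t3 := t2 b hb (g a) (hg a ha).2
    rw [(hg b hb).1] at hd
    rw [(hg a ha).1] at t3
    have t4 : |f b (g a)| ≤ 2 * L * |b - a| := by
      have h1 : |b - a| ≤ 1 := by
        rw [abs_le]
        constructor <;> linarith [ha.1, ha.2, hb.1, hb.2]
      have h2 : f b (g a) = (f b (g a) - 0 - fx a (g a) * (b - a) -
          deriv (f a) (g a) * (g a - g a)) + fx a (g a) * (b - a) := by ring
      rw [h2]
      refine (abs_add_le _ _).trans ?_
      rw [abs_mul]
      have h3 := mul_le_mul_of_nonneg_right t1 (abs_nonneg (b - a))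
      have h4 : (b - a) ^ 2 ≤ |b - a| := by
        rw [← sq_abs]
        nlinarith [abs_nonneg (b - a)]
      have h5 := mul_le_mul_of_nonneg_left h4 hL
      simp only [sub_self, ne_eq, OfNat.ofNat_ne_zero, not_false_eq_true, zero_pow, add_zero,
        mul_zero] at t3 ⊢
      linarith
    have t5 : |f b (g a)| = d * |g b - g a| := by
      rw [← abs_of_pos (hm.trans_le hd1), ← abs_mul, ← hd, zero_sub, abs_neg]
    rw [hK, div_mul_eq_mul_div, le_div_iff₀ hm]
    nlinarith [abs_nonneg (g b - g a)]
  refine ⟨M + L / m + L * (1 + K ^ 2) / m, by positivity, g,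
    fun a => -fx a (g a) / deriv (f a) (g a), fun a ha => ?_⟩
  have hpos := hm.trans_le (hfy a ha (g a))
  obtain ⟨t1, t2⟩ := hT a ha (g a) (hg a ha).2
  have n1 : 0 ≤ L / m := by positivity
  have n2 : 0 ≤ L * (1 + K ^ 2) / m := by positivity
  refine ⟨(hg a ha).1, ?_, ?_, fun b hb => ?_⟩
  · have := abs_le.2 (hg a ha).2
    linarith
  · rw [abs_div, abs_neg, abs_of_pos hpos]
    have : |fx a (g a)| / deriv (f a) (g a) ≤ L / m :=
      div_le_div₀ hL t1 hm (hfy a ha (g a))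
    linarith
  · have t3 := t2 b hb (g b) (hg b hb).2
    rw [(hg a ha).1, (hg b hb).1] at t3
    have t4 : (g b - g a) ^ 2 ≤ K ^ 2 * (b - a) ^ 2 := by
      rw [← sq_abs (g b - g a), ← sq_abs (b - a), ← mul_pow]
      exact pow_le_pow_left₀ (abs_nonneg _) (hlip a ha b hb) 2
    have e : g b - g a - -fx a (g a) / deriv (f a) (g a) * (b - a) =
        -(0 - 0 - fx a (g a) * (b - a) - deriv (f a) (g a) * (g b - g a)) /
          deriv (f a) (g a) := by
      field_simp
      ring
    rw [e, abs_div, abs_neg, abs_of_pos hpos]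
    have t5 : |0 - 0 - fx a (g a) * (b - a) - deriv (f a) (g a) * (g b - g a)| /
        deriv (f a) (g a) ≤ (L * (1 + K ^ 2) * (b - a) ^ 2) / m := by
      refine div_le_div₀ (by positivity) (t3.trans ?_) hm (hfy a ha (g a))
      have := mul_le_mul_of_nonneg_left t4 hL
      linarith
    have n3 := mul_nonneg (add_nonneg hMnn n1) (sq_nonneg (b - a))
    rw [mul_div_right_comm] at t5
    linarith

/-- The sum of the two exponential boundary layer functions. -/
noncomputable def layer (a ε x : ℝ) : ℝ :=
  Real.exp (-(a * x / ε)) + Real.exp (-(a * (1 - x) / ε))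

theorem layer_nonneg (a ε x : ℝ) : 0 ≤ layer a ε x := by unfold layer; positivity

theorem layer_le_two {a ε x : ℝ} (ha : 0 ≤ a) (hε : 0 < ε) (hx : x ∈ Set.Icc (0 : ℝ) 1) :
    layer a ε x ≤ 2 := by
  have h1 : Real.exp (-(a * x / ε)) ≤ 1 :=
    Real.exp_le_one_iff.2 (neg_nonpos.2 (div_nonneg (mul_nonneg ha hx.1) hε.le))
  have h2 : Real.exp (-(a * (1 - x) / ε)) ≤ 1 :=
    Real.exp_le_one_iff.2 (neg_nonpos.2 (div_nonneg (mul_nonneg ha (sub_nonneg.2 hx.2)) hε.le))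
  unfold layer
  linarith

theorem layer_le_mul_layer {a ε x t r : ℝ} (ha : 0 ≤ a) (hε : 0 < ε) (h : |t - x| ≤ r) :
    layer a ε t ≤ Real.exp (a * r / ε) * layer a ε x := by
  obtain ⟨h1, h2⟩ := abs_le.1 h
  unfold layer
  rw [mul_add, ← Real.exp_add, ← Real.exp_add]
  refine add_le_add (Real.exp_le_exp.2 ?_) (Real.exp_le_exp.2 ?_) <;>
    rw [← sub_nonneg]
  · have : a * r / ε + -(a * x / ε) - -(a * t / ε) = a * (r + (t - x)) / ε := by ring
    rw [this]
    exact div_nonneg (mul_nonneg ha (by linarith)) hε.le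
  · have : a * r / ε + -(a * (1 - x) / ε) - -(a * (1 - t) / ε) = a * (r - (t - x)) / ε := by ring
    rw [this]
    exact div_nonneg (mul_nonneg ha (by linarith)) hε.le

theorem nonpos_of_isLocalMax_of_hasDerivAt {χ χ1 : ℝ → ℝ} {c x₀ : ℝ}
    (h : ∀ᶠ t in nhds x₀, HasDerivAt χ (χ1 t) t) (h1 : HasDerivAt χ1 c x₀)
    (hmax : IsLocalMax χ x₀) : c ≤ 0 := by
  by_contra! hc
  have e1 : deriv χ =ᶠ[nhds x₀] χ1 := h.mono fun t ht => ht.deriv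
  have hmin : IsLocalMin χ x₀ := isLocalMin_of_deriv_deriv_pos
    (by rw [e1.deriv_eq, h1.deriv]; exact hc) hmax.deriv_eq_zero h.self_of_nhds.continuousAt
  have e2 : χ =ᶠ[nhds x₀] fun _ => χ x₀ := by
    filter_upwards [hmax, hmin] with t h1 h2 using le_antisymm h1 h2
  have e3 : χ1 =ᶠ[nhds x₀] fun _ => 0 := e1.symm.trans (by simpa using e2.deriv)
  have := e3.deriv_eq
  rw [h1.deriv, deriv_const] at this
  exact hc.ne' this

theorem continuousOn_of_linear_approx {g G : ℝ → ℝ} {L : ℝ} {s : Set ℝ}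
    (hg : ∀ a ∈ s, ∀ b ∈ s, |g b - g a - G a * (b - a)| ≤ L * (b - a) ^ 2) :
    ContinuousOn g s := by
  intro a ha
  have hlim : Filter.Tendsto (fun b => L * (b - a) ^ 2 + |G a * (b - a)|)
      (nhdsWithin a s) (nhds 0) := by
    have : ContinuousAt (fun b => L * (b - a) ^ 2 + |G a * (b - a)|) a := by fun_prop
    have h2 := this.tendsto.mono_left (nhdsWithin_le_nhds (s := s))
    simpa using h2
  rw [ContinuousWithinAt, tendsto_iff_norm_sub_tendsto_zero]
  refine squeeze_zero' (Filter.Eventually.of_forall fun _ => norm_nonneg _) ?_ hlim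
  filter_upwards [self_mem_nhdsWithin] with b hb
  rw [Real.norm_eq_abs, show g b - g a = (g b - g a - G a * (b - a)) + G a * (b - a) by ring]
  exact (abs_add_le _ _).trans (add_le_add_left (hg a ha b hb) _)

theorem hasDerivAt_layer (a ε t : ℝ) :
    HasDerivAt (layer a ε) (-(a / ε) * Real.exp (-(a * t / ε)) +
      (a / ε) * Real.exp (-(a * (1 - t) / ε))) t ∧
    HasDerivAt (fun t => -(a / ε) * Real.exp (-(a * t / ε)) +
      (a / ε) * Real.exp (-(a * (1 - t) / ε))) ((a / ε) ^ 2 * layer a ε t) t := by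
  have h1 : HasDerivAt (fun t => Real.exp (-(a * t / ε)))
      (Real.exp (-(a * t / ε)) * -(a * 1 / ε)) t :=
    ((((hasDerivAt_id t).const_mul a).div_const ε).neg).exp
  have h2 : HasDerivAt (fun t => Real.exp (-(a * (1 - t) / ε)))
      (Real.exp (-(a * (1 - t) / ε)) * -(a * -1 / ε)) t :=
    (((((hasDerivAt_id t).const_sub 1).const_mul a).div_const ε).neg).exp
  constructor
  · exact (h1.add h2).congr_deriv (by ring)
  · exact ((h1.const_mul _).add (h2.const_mul _)).congr_deriv (by unfold layer; ring)

theorem sub_le_layer {y y1 y2 g G : ℝ → ℝ} {ε m L : ℝ} (hε : 0 < ε) (hm : 0 < m)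
    (hy : ContinuousOn y (Set.Icc 0 1)) (hy0 : y 0 = 0) (hy1 : y 1 = 0)
    (hd : ∀ t ∈ Set.Ioo (0 : ℝ) 1, HasDerivAt y (y1 t) t)
    (hd1 : ∀ t ∈ Set.Ioo (0 : ℝ) 1, HasDerivAt y1 (y2 t) t)
    (hgL : ∀ a ∈ Set.Icc (0 : ℝ) 1, |g a| ≤ L)
    (hg : ∀ a ∈ Set.Icc (0 : ℝ) 1, ∀ b ∈ Set.Icc (0 : ℝ) 1,
      |g b - g a - G a * (b - a)| ≤ L * (b - a) ^ 2)
    (hode : ∀ t ∈ Set.Ioo (0 : ℝ) 1, g t < y t → m * (y t - g t) ≤ ε ^ 2 * y2 t) :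
    ∀ t ∈ Set.Icc (0 : ℝ) 1,
      y t - g t ≤ 2 * L * ε ^ 2 / m + L * layer (Real.sqrt m) ε t := by
  have hL : 0 ≤ L := (abs_nonneg _).trans (hgL 0 (by simp))
  have hlay : Continuous (layer (Real.sqrt m) ε) :=
    continuous_iff_continuousAt.2 fun t => (hasDerivAt_layer _ _ t).1.continuousAt
  obtain ⟨x₀, hx₀, hmax⟩ := isCompact_Icc.exists_isMaxOn (Set.nonempty_Icc.2 zero_le_one)
    ((hy.sub (continuousOn_of_linear_approx hg)).sub (hlay.continuousOn.const_smul L))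
  have hmax' : ∀ t ∈ Set.Icc (0 : ℝ) 1, y t - g t - L * layer (Real.sqrt m) ε t ≤
      y x₀ - g x₀ - L * layer (Real.sqrt m) ε x₀ := fun t ht => hmax ht
  suffices y x₀ - g x₀ - L * layer (Real.sqrt m) ε x₀ ≤ 2 * L * ε ^ 2 / m from
    fun t ht => by linarith [hmax' t ht]
  have hc : 0 ≤ 2 * L * ε ^ 2 / m := by positivity
  have hend : ∀ t ∈ Set.Icc (0 : ℝ) 1, y t = 0 → 1 ≤ layer (Real.sqrt m) ε t →
      y t - g t - L * layer (Real.sqrt m) ε t ≤ 2 * L * ε ^ 2 / m := by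
    intro t ht h0 h1
    have := (abs_le.1 (hgL t ht)).1
    rw [h0]
    nlinarith
  rcases eq_or_lt_of_le hx₀.1 with h | h0
  · subst h
    refine hend 0 hx₀ hy0 ?_
    unfold layer
    simp [(Real.exp_pos _).le]
  rcases eq_or_lt_of_le hx₀.2 with h | h1
  · subst h
    refine hend 1 hx₀ hy1 ?_
    unfold layer
    simp [(Real.exp_pos _).le]
  by_contra! hcon
  have hmem : x₀ ∈ Set.Ioo (0 : ℝ) 1 := ⟨h0, h1⟩
  have hnhds : Set.Ioo (0 : ℝ) 1 ∈ nhds x₀ := isOpen_Ioo.mem_nhds hmem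
  have hloc : IsLocalMax (fun t => y t - L * layer (Real.sqrt m) ε t - G x₀ * (t - x₀) -
      L * (t - x₀) ^ 2) x₀ := by
    filter_upwards [hnhds] with t ht
    have ht' := Set.Ioo_subset_Icc_self ht
    have := (abs_le.1 (hg x₀ hx₀ t ht')).2
    have := hmax' t ht'
    simp only [sub_self]
    linarith
  have hsecond := nonpos_of_isLocalMax_of_hasDerivAt
    (χ1 := fun t => y1 t - L * (-(Real.sqrt m / ε) * Real.exp (-(Real.sqrt m * t / ε)) +
      (Real.sqrt m / ε) * Real.exp (-(Real.sqrt m * (1 - t) / ε))) - G x₀ * 1 -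
      L * (2 * (t - x₀)))
    (c := y2 x₀ - L * ((Real.sqrt m / ε) ^ 2 * layer (Real.sqrt m) ε x₀) - 0 - L * (2 * 1))
    (by
      filter_upwards [hnhds] with t ht
      have e := (hasDerivAt_id t).sub_const x₀
      exact ((((hd t ht).sub ((hasDerivAt_layer _ _ t).1.const_mul L)).sub
        (e.const_mul (G x₀))).sub ((e.pow 2).const_mul L)).congr_deriv (by simp))
    ((((hd1 x₀ hmem).sub ((hasDerivAt_layer _ _ x₀).2.const_mul L)).sub
      (hasDerivAt_const x₀ _)).sub
      ((((hasDerivAt_id x₀).sub_const x₀).const_mul 2).const_mul L)) hloc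
  have hlay0 := mul_nonneg hL (layer_nonneg (Real.sqrt m) ε x₀)
  have hbig := hode x₀ hmem (by linarith)
  rw [div_pow, Real.sq_sqrt hm.le] at hsecond
  have h3 : ε ^ 2 * y2 x₀ ≤ ε ^ 2 * (L * (m / ε ^ 2 * layer (Real.sqrt m) ε x₀) + 2 * L) :=
    mul_le_mul_of_nonneg_left (by linarith) (by positivity)
  have h4 : ε ^ 2 * (L * (m / ε ^ 2 * layer (Real.sqrt m) ε x₀) + 2 * L) =
      m * (L * layer (Real.sqrt m) ε x₀ + 2 * L * ε ^ 2 / m) := by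
    field_simp
  rw [h4] at h3
  have := le_of_mul_le_mul_left (hbig.trans h3) hm
  linarith

/-- `y` solves the boundary value problem, with first and second derivatives `y1` and `y2`. -/
structure IsClassicalSolution (f : ℝ → ℝ → ℝ) (ε : ℝ) (y y1 y2 : ℝ → ℝ) : Prop where
  continuousOn : ContinuousOn y (Set.Icc 0 1)
  continuousOn_deriv : ContinuousOn y1 (Set.Icc 0 1)
  left : y 0 = 0
  right : y 1 = 0
  hasDerivAt : ∀ t ∈ Set.Ioo (0 : ℝ) 1, HasDerivAt y (y1 t) t
  hasDerivAt_deriv : ∀ t ∈ Set.Ioo (0 : ℝ) 1, HasDerivAt y1 (y2 t) t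
  ode : ∀ t ∈ Set.Ioo (0 : ℝ) 1, ε ^ 2 * y2 t = f t (y t)

theorem isClassicalSolution_of_contDiffOn {f : ℝ → ℝ → ℝ} {ε : ℝ} {y : ℝ → ℝ}
    (hy : ContDiffOn ℝ 2 y (Set.Icc 0 1)) (h0 : y 0 = 0) (h1 : y 1 = 0)
    (hode : ∀ a ∈ Set.Ioo (0:ℝ) 1,
      ε ^ 2 * iteratedDerivWithin 2 y (Set.Icc 0 1) a = f a (y a)) :
    IsClassicalSolution f ε y (derivWithin y (Set.Icc 0 1))
      (iteratedDerivWithin 2 y (Set.Icc 0 1)) := by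
  have hu : UniqueDiffOn ℝ (Set.Icc (0 : ℝ) 1) := uniqueDiffOn_Icc zero_lt_one
  have hy1 : ContDiffOn ℝ 1 (derivWithin y (Set.Icc 0 1)) (Set.Icc 0 1) :=
    hy.derivWithin hu (by norm_num)
  have hn : ∀ t ∈ Set.Ioo (0 : ℝ) 1, Set.Icc (0 : ℝ) 1 ∈ nhds t := fun t ht =>
    Icc_mem_nhds ht.1 ht.2
  refine ⟨hy.continuousOn, hy1.continuousOn, h0, h1, fun t ht => ?_, fun t ht => ?_, hode⟩
  · exact ((hy.differentiableOn (by norm_num) t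
      (Set.Ioo_subset_Icc_self ht)).hasDerivWithinAt).hasDerivAt (hn t ht)
  · have := ((hy1.differentiableOn (by norm_num) t
      (Set.Ioo_subset_Icc_self ht)).hasDerivWithinAt).hasDerivAt (hn t ht)
    refine this.congr_deriv ?_
    rw [iteratedDerivWithin_succ, iteratedDerivWithin_one]

theorem abs_sub_linear_le {y y1 y2 : ℝ → ℝ} {a b s t M : ℝ}
    (hy : ContinuousOn y (Set.Icc a b))
    (hd : ∀ t ∈ Set.Ioo a b, HasDerivAt y (y1 t) t)
    (hd1 : ∀ t ∈ Set.Ioo a b, HasDerivAt y1 (y2 t) t)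
    (hM : ∀ t ∈ Set.Ioo a b, |y2 t| ≤ M) (hs : s ∈ Set.Ioo a b) (ht : t ∈ Set.Icc a b) :
    |y t - y s - y1 s * (t - s)| ≤ M * (t - s) ^ 2 := by
  have hM0 : 0 ≤ M := (abs_nonneg _).trans (hM s hs)
  have hlip : ∀ ξ ∈ Set.Ioo a b, |y1 ξ - y1 s| ≤ M * |ξ - s| := fun ξ hξ =>
    (convex_Ioo a b).norm_image_sub_le_of_norm_hasDerivWithin_le
      (fun x hx => (hd1 x hx).hasDerivWithinAt) hM hs hξ
  have key : ∃ ξ ∈ Set.Ioo a b, |ξ - s| ≤ |t - s| ∧ y t - y s = y1 ξ * (t - s) := by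
    rcases lt_trichotomy s t with h | rfl | h
    · obtain ⟨ξ, hξ, e⟩ := exists_hasDerivAt_eq_slope y y1 h
        (hy.mono (Set.Icc_subset_Icc hs.1.le ht.2))
        (fun x hx => hd x ⟨hs.1.trans hx.1, hx.2.trans_le ht.2⟩)
      refine ⟨ξ, ⟨hs.1.trans hξ.1, hξ.2.trans_le ht.2⟩, ?_, ?_⟩
      · rw [abs_of_pos (sub_pos.2 hξ.1), abs_of_pos (sub_pos.2 h)]
        linarith [hξ.2]
      · rw [e, div_mul_cancel₀ _ (sub_pos.2 h).ne']
    · exact ⟨s, hs, le_rfl, by simp⟩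
    · obtain ⟨ξ, hξ, e⟩ := exists_hasDerivAt_eq_slope y y1 h
        (hy.mono (Set.Icc_subset_Icc ht.1 hs.2.le))
        (fun x hx => hd x ⟨ht.1.trans_lt hx.1, hx.2.trans hs.2⟩)
      refine ⟨ξ, ⟨ht.1.trans_lt hξ.1, hξ.2.trans hs.2⟩, ?_, ?_⟩
      · rw [abs_of_neg (sub_neg.2 hξ.2), abs_of_neg (sub_neg.2 h)]
        linarith [hξ.1]
      · have h' := (sub_pos.2 h).ne'
        rw [e]
        field_simp
        ring
  obtain ⟨ξ, hξ, h1, h2⟩ := key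
  rw [h2, ← sub_mul, abs_mul, ← sq_abs (t - s), sq, ← mul_assoc]
  exact mul_le_mul_of_nonneg_right
    ((hlip ξ hξ).trans (mul_le_mul_of_nonneg_left h1 hM0)) (abs_nonneg _)

theorem IsClassicalSolution.abs_sub_le {f : ℝ → ℝ → ℝ} {m γ ε L : ℝ} {y y1 y2 g G : ℝ → ℝ}
    (hsol : IsClassicalSolution f ε y y1 y2) (hε : 0 < ε) (hm : 0 < m)
    (hfy : ∀ a ∈ Set.Icc (0:ℝ) 1, ∀ u : ℝ, m ≤ deriv (f a) u)
    (hγ : ∀ a ∈ Set.Icc (0:ℝ) 1, ∀ u : ℝ, deriv (f a) u ≤ γ)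
    (hg : ∀ a ∈ Set.Icc (0 : ℝ) 1, f a (g a) = 0 ∧ |g a| ≤ L ∧ |G a| ≤ L ∧
      ∀ b ∈ Set.Icc (0 : ℝ) 1, |g b - g a - G a * (b - a)| ≤ L * (b - a) ^ 2) :
    ∀ t ∈ Set.Icc (0 : ℝ) 1,
      |y t - g t| ≤ 2 * L * ε ^ 2 / m + L * layer (Real.sqrt m) ε t := by
  intro t ht
  have h1 := sub_le_layer hε hm hsol.continuousOn hsol.left hsol.right hsol.hasDerivAt
    hsol.hasDerivAt_deriv (fun a ha => (hg a ha).2.1) (fun a ha => (hg a ha).2.2.2)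
    (fun t ht h => by
      have ht' := Set.Ioo_subset_Icc_self ht
      have := (slope_bounds hm (hfy t ht') (hγ t ht') h.le).1
      rw [(hg t ht').1] at this
      rw [hsol.ode t ht]
      linarith) t ht
  have h2 := sub_le_layer (y := fun t => -y t) (y1 := fun t => -y1 t) (y2 := fun t => -y2 t)
    (g := fun t => -g t) (G := fun t => -G t) (L := L) hε hm hsol.continuousOn.neg
    (by simp [hsol.left]) (by simp [hsol.right])
    (fun t ht => (hsol.hasDerivAt t ht).neg) (fun t ht => (hsol.hasDerivAt_deriv t ht).neg)
    (fun a ha => by rw [abs_neg]; exact (hg a ha).2.1)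
    (fun a ha b hb => by
      rw [← abs_neg]
      convert (hg a ha).2.2.2 b hb using 2
      ring)
    (fun t ht h => by
      have ht' := Set.Ioo_subset_Icc_self ht
      have := (slope_bounds hm (hfy t ht') (hγ t ht') (neg_lt_neg_iff.1 h).le).1
      rw [(hg t ht').1] at this
      have := hsol.ode t ht
      linarith) t ht
  exact abs_le.2 ⟨by linarith, h1⟩

theorem exists_solution_bounds {f : ℝ → ℝ → ℝ} {m γ : ℝ} {k : ℕ} (hm : 0 < m) (hk : 2 ≤ k)
    (hf : ContDiffOn ℝ k (Function.uncurry f) (Set.Icc 0 1 ×ˢ Set.univ))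
    (hfy : ∀ a ∈ Set.Icc (0:ℝ) 1, ∀ u : ℝ, m ≤ deriv (f a) u)
    (hγ : ∀ a ∈ Set.Icc (0:ℝ) 1, ∀ u : ℝ, deriv (f a) u ≤ γ) :
    ∃ M ≥ (0 : ℝ), ∃ g G : ℝ → ℝ,
      (∀ a ∈ Set.Icc (0 : ℝ) 1, |G a| ≤ M ∧
        ∀ b ∈ Set.Icc (0 : ℝ) 1, |g b - g a - G a * (b - a)| ≤ M * (b - a) ^ 2) ∧
      ∀ (ε : ℝ) (y y1 y2 : ℝ → ℝ), 0 < ε → ε ≤ 1 / 2 → IsClassicalSolution f ε y y1 y2 →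
        (∀ t ∈ Set.Icc (0 : ℝ) 1, |y t| ≤ M ∧
          |y t - g t| ≤ M * (ε ^ 2 + layer (Real.sqrt m) ε t) ∧
          |f t (y t)| ≤ M * (ε ^ 2 + layer (Real.sqrt m) ε t)) ∧
        ∀ t ∈ Set.Ioo (0 : ℝ) 1, ε ^ 2 * |y2 t| ≤ M * (ε ^ 2 + layer (Real.sqrt m) ε t) ∧
          ε * |y1 t| ≤ M * (ε + layer (Real.sqrt m) ε t) := by
  obtain ⟨L, hL, g, G, hg⟩ := exists_reduced_solution hm hk hf hfy hγ
  have hγ0 : 0 < γ := hm.trans_le ((hfy 0 (by simp) 0).trans (hγ 0 (by simp) 0))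
  set K := 2 * L / m + L with hK
  have hK0 : 0 ≤ K := by positivity
  set q := Real.exp (Real.sqrt m) with hq
  have hq0 : 0 < q := Real.exp_pos _
  set M := L + 3 * K + γ * K + (2 * L + 2 * K + K * (1 + q) + γ * K * (1 + q)) with hMdef
  have hM0 : 0 ≤ M := by positivity
  have hLM : L ≤ M := by
    have : 0 ≤ 3 * K + γ * K + (2 * L + 2 * K + K * (1 + q) + γ * K * (1 + q)) := by positivity
    linarith
  refine ⟨M, hM0, g, G, fun a ha => ⟨(hg a ha).2.2.1.trans hLM, fun b hb =>
    ((hg a ha).2.2.2 b hb).trans (mul_le_mul_of_nonneg_right hLM (sq_nonneg _))⟩,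
    fun ε y y1 y2 hε hε2 hsol => ?_⟩
  have hsm := Real.sqrt_nonneg m
  have hdiff : ∀ t ∈ Set.Icc (0 : ℝ) 1, |y t - g t| ≤ K * (ε ^ 2 + layer (Real.sqrt m) ε t) := by
    intro t ht
    refine (hsol.abs_sub_le hε hm hfy hγ hg t ht).trans ?_
    have h1 : 0 ≤ L * ε ^ 2 := by positivity
    have h2 : 0 ≤ 2 * L / m * layer (Real.sqrt m) ε t :=
      mul_nonneg (by positivity) (layer_nonneg _ _ _)
    rw [hK, show 2 * L * ε ^ 2 / m = 2 * L / m * ε ^ 2 by ring]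
    linarith
  have hfb : ∀ t ∈ Set.Icc (0 : ℝ) 1,
      |f t (y t)| ≤ γ * K * (ε ^ 2 + layer (Real.sqrt m) ε t) := by
    intro t ht
    obtain ⟨d, d1, d2, hd⟩ := exists_slope hm (hfy t ht) (hγ t ht) (y t) (g t)
    rw [(hg t ht).1, sub_zero] at hd
    rw [hd, abs_mul, abs_of_pos (hm.trans_le d1), mul_assoc]
    exact mul_le_mul d2 (hdiff t ht) (abs_nonneg _) hγ0.le
  have hy2 : ∀ t ∈ Set.Ioo (0 : ℝ) 1,
      ε ^ 2 * |y2 t| ≤ γ * K * (ε ^ 2 + layer (Real.sqrt m) ε t) := by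
    intro t ht
    rw [← abs_of_nonneg (sq_nonneg ε), ← abs_mul, abs_of_nonneg (sq_nonneg ε), hsol.ode t ht]
    exact hfb t (Set.Ioo_subset_Icc_self ht)
  have hle : ∀ c, c ≤ M → ∀ t : ℝ, c * (ε ^ 2 + layer (Real.sqrt m) ε t) ≤
      M * (ε ^ 2 + layer (Real.sqrt m) ε t) := fun c hc t =>
    mul_le_mul_of_nonneg_right hc (add_nonneg (sq_nonneg _) (layer_nonneg _ _ _))
  have hKM : K ≤ M := by
    have : 0 ≤ L + 2 * K + γ * K + (2 * L + 2 * K + K * (1 + q) + γ * K * (1 + q)) := by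
      positivity
    linarith
  have hγKM : γ * K ≤ M := by
    have : 0 ≤ L + 3 * K + (2 * L + 2 * K + K * (1 + q) + γ * K * (1 + q)) := by
      positivity
    linarith
  refine ⟨fun t ht => ⟨?_, (hdiff t ht).trans (hle K hKM t), (hfb t ht).trans (hle _ hγKM t)⟩,
    fun t ht => ⟨(hy2 t ht).trans (hle _ hγKM t), ?_⟩⟩
  · have h1 := hdiff t ht
    have h2 : ε ^ 2 + layer (Real.sqrt m) ε t ≤ 3 := by
      have := layer_le_two hsm hε ht
      nlinarith
    have h3 := mul_le_mul_of_nonneg_left h2 hK0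
    have h4 : |y t| ≤ |y t - g t| + |g t| := by simpa using abs_add_le (y t - g t) (g t)
    have h5 := (hg t ht).2.1
    have : 0 ≤ γ * K + (2 * L + 2 * K + K * (1 + q) + γ * K * (1 + q)) := by positivity
    linarith
  set E := layer (Real.sqrt m) ε t with hE
  have hE0 : 0 ≤ E := layer_nonneg _ _ _
  have hEt : ∀ s, |s - t| ≤ ε → layer (Real.sqrt m) ε s ≤ q * E := by
    intro s hs
    have := layer_le_mul_layer hsm hε hs
    rwa [mul_div_assoc, div_self hε.ne', mul_one] at this
  obtain ⟨t', ht', htt⟩ : ∃ t' ∈ Set.Icc (0 : ℝ) 1, |t' - t| = ε := by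
    rcases le_total (t + ε) 1 with h | h
    · exact ⟨t + ε, ⟨by linarith [ht.1], h⟩, by simp [abs_of_pos hε]⟩
    · exact ⟨t - ε, ⟨by linarith, by linarith [ht.2]⟩, by simp [abs_of_pos hε]⟩
  have htt' := abs_le.1 htt.le
  have hsub : ∀ s ∈ Set.Ioo (max 0 (t - ε)) (min 1 (t + ε)),
      s ∈ Set.Ioo (0 : ℝ) 1 ∧ |s - t| ≤ ε := by
    intro s hs
    obtain ⟨h1, h2⟩ := max_lt_iff.1 hs.1
    obtain ⟨h3, h4⟩ := lt_min_iff.1 hs.2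
    exact ⟨⟨h1, h3⟩, abs_le.2 ⟨by linarith, by linarith⟩⟩
  have htay := abs_sub_linear_le (a := max 0 (t - ε)) (b := min 1 (t + ε)) (s := t) (t := t')
    (M := γ * K * (ε ^ 2 + q * E) / ε ^ 2)
    (hsol.continuousOn.mono (Set.Icc_subset_Icc (le_max_left _ _) (min_le_left _ _)))
    (fun s hs => hsol.hasDerivAt s (hsub s hs).1)
    (fun s hs => hsol.hasDerivAt_deriv s (hsub s hs).1)
    (fun s hs => by
      rw [le_div_iff₀ (by positivity), mul_comm]
      refine (hy2 s (hsub s hs).1).trans (mul_le_mul_of_nonneg_left ?_ (by positivity))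
      linarith [hEt s (hsub s hs).2])
    ⟨max_lt ht.1 (by linarith), lt_min ht.2 (by linarith)⟩
    ⟨max_le ht'.1 (by linarith), le_min ht'.2 (by linarith)⟩
  rw [← sq_abs (t' - t), htt, div_mul_cancel₀ _ (by positivity)] at htay
  have htI := Set.Ioo_subset_Icc_self ht
  have hgd : |g t' - g t| ≤ L * ε + L * ε ^ 2 := by
    have h1 := (hg t htI).2.2.2 t' ht'
    rw [← sq_abs (t' - t), htt] at h1
    have h2 : |G t * (t' - t)| ≤ L * ε := by
      rw [abs_mul, htt]
      exact mul_le_mul_of_nonneg_right (hg t htI).2.2.1 hε.le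
    have h3 := abs_add_le (g t' - g t - G t * (t' - t)) (G t * (t' - t))
    rw [sub_add_cancel] at h3
    linarith
  have hyd : |y1 t * (t' - t)| ≤ |y t' - y t - y1 t * (t' - t)| +
      (|y t' - g t'| + |g t' - g t| + |y t - g t|) := by
    have h0 := congrArg abs (show y1 t * (t' - t) = (y t' - g t') + (g t' - g t) -
      (y t - g t) - (y t' - y t - y1 t * (t' - t)) by ring)
    have h1 := abs_sub ((y t' - g t') + (g t' - g t) - (y t - g t))
      (y t' - y t - y1 t * (t' - t))
    have h2 := abs_sub ((y t' - g t') + (g t' - g t)) (y t - g t)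
    have h3 := abs_add_le (y t' - g t') (g t' - g t)
    linarith
  rw [abs_mul, htt] at hyd
  have k1 := hdiff t' ht'
  have k2 := hdiff t htI
  have k3 : K * (ε ^ 2 + layer (Real.sqrt m) ε t') ≤ K * (ε ^ 2 + q * E) :=
    mul_le_mul_of_nonneg_left (by linarith [hEt t' htt.le]) hK0
  have k4 : ε ^ 2 ≤ ε := by nlinarith
  rw [mul_comm]
  have k5 : |y1 t| * ε ≤ γ * K * (ε ^ 2 + q * E) + (K * (ε ^ 2 + q * E) + (L * ε + L * ε ^ 2) +
      K * (ε ^ 2 + E)) := by linarith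
  have k6 : γ * K * (ε ^ 2 + q * E) + (K * (ε ^ 2 + q * E) + (L * ε + L * ε ^ 2) +
      K * (ε ^ 2 + E)) ≤ (2 * L + 2 * K + γ * K) * ε + (K * (1 + q) + γ * K * q) * E := by
    have : 0 ≤ (γ * K + 2 * K + L) * (ε - ε ^ 2) :=
      mul_nonneg (by positivity) (by linarith)
    linarith
  have k7 : 0 ≤ (M - (2 * L + 2 * K + γ * K)) * ε := by
    refine mul_nonneg ?_ hε.le
    have : 0 ≤ L + 3 * K + (K * (1 + q) + γ * K * (1 + q)) := by positivity
    linarith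
  have k8 : 0 ≤ (M - (K * (1 + q) + γ * K * q)) * E := by
    refine mul_nonneg ?_ hE0
    have : 0 ≤ L + 3 * K + γ * K + (2 * L + 2 * K + γ * K) := by positivity
    linarith
  linarith

theorem exists_layer_linearization {f : ℝ → ℝ → ℝ} {m γ : ℝ} {k : ℕ} (hm : 0 < m) (hk : 2 ≤ k)
    (hf : ContDiffOn ℝ k (Function.uncurry f) (Set.Icc 0 1 ×ˢ Set.univ))
    (hfy : ∀ a ∈ Set.Icc (0:ℝ) 1, ∀ u : ℝ, m ≤ deriv (f a) u)
    (hγ : ∀ a ∈ Set.Icc (0:ℝ) 1, ∀ u : ℝ, deriv (f a) u ≤ γ) {M w : ℝ} (hM : 0 ≤ M)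
    (hw : 0 ≤ w) :
    ∃ C ≥ (0 : ℝ), ∀ (ε : ℝ) (y y1 y2 : ℝ → ℝ), 0 < ε → ε ≤ 1 →
      IsClassicalSolution f ε y y1 y2 → (∀ t ∈ Set.Icc (0 : ℝ) 1, |y t| ≤ M) →
      (∀ t ∈ Set.Ioo (0 : ℝ) 1, ε ^ 2 * |y2 t| ≤ M * (ε ^ 2 + layer (Real.sqrt m) ε t) ∧
        ε * |y1 t| ≤ M * (ε + layer (Real.sqrt m) ε t)) →
      ∀ s h : ℝ, 0 < h → h ≤ w * ε → 0 ≤ s - h → s + h ≤ 1 →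
        ∃ D, ∀ t ∈ Set.Icc (s - h) (s + h),
          |f t (y t) - γ * y t - (f s (y s) - γ * y s + D * (t - s))| ≤
            C * (h ^ 2 + (h / ε) ^ 2 * layer (Real.sqrt m) ε s) := by
  obtain ⟨L, hL, fx, hT⟩ := exists_taylor_bound hk hf M
  have hγ0 : 0 < γ := hm.trans_le ((hfy 0 (by simp) 0).trans (hγ 0 (by simp) 0))
  have hsm := Real.sqrt_nonneg m
  set Q := Real.exp (Real.sqrt m * w) with hQ
  have hQ1 : 1 ≤ Q := Real.one_le_exp (by positivity)
  set P := M * (1 + w) * Q with hP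
  have hP0 : 0 ≤ P := by positivity
  refine ⟨L * (1 + 4 * P ^ 2) + γ * (M * Q), by positivity,
    fun ε y y1 y2 hε hε1 hsol hyM hb s h hh hhw h0 h1 => ?_⟩
  set E := layer (Real.sqrt m) ε s with hE
  have hE0 : 0 ≤ E := layer_nonneg _ _ _
  have hs : s ∈ Set.Ioo (0 : ℝ) 1 := ⟨by linarith, by linarith⟩
  have hsI := Set.Ioo_subset_Icc_self hs
  have hE2 : E ≤ 2 := layer_le_two hsm hε hsI
  obtain ⟨r, hr⟩ : ∃ r, r = h / ε := ⟨_, rfl⟩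
  have hrh : h = r * ε := by rw [hr, div_mul_cancel₀ _ hε.ne']
  have hr0 : 0 < r := by rw [hr]; positivity
  have hrw : r ≤ w := by rwa [hr, div_le_iff₀ hε]
  rw [← hr]
  have hEt : ∀ t, |t - s| ≤ h → layer (Real.sqrt m) ε t ≤ Q * E := by
    intro t ht
    refine (layer_le_mul_layer hsm hε ht).trans (mul_le_mul_of_nonneg_right ?_ hE0)
    rw [hQ, mul_div_assoc, ← hr]
    exact Real.exp_le_exp.2 (mul_le_mul_of_nonneg_left hrw hsm)
  refine ⟨fx s (y s) + (deriv (f s) (y s) - γ) * y1 s, fun t ht => ?_⟩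
  have htI : t ∈ Set.Icc (0 : ℝ) 1 := ⟨h0.trans ht.1, ht.2.trans h1⟩
  have hts : |t - s| ≤ h := abs_le.2 ⟨by linarith [ht.1], by linarith [ht.2]⟩
  have hts2 : (t - s) ^ 2 ≤ h ^ 2 := sq_le_sq' (abs_le.1 hts).1 (abs_le.1 hts).2
  have hS := abs_sub_linear_le (a := s - h) (b := s + h) (s := s) (t := t)
    (M := M * (ε ^ 2 + Q * E) / ε ^ 2)
    (hsol.continuousOn.mono (Set.Icc_subset_Icc h0 h1))
    (fun t ht => hsol.hasDerivAt t ⟨h0.trans_lt ht.1, ht.2.trans_le h1⟩)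
    (fun t ht => hsol.hasDerivAt_deriv t ⟨h0.trans_lt ht.1, ht.2.trans_le h1⟩)
    (fun t ht => by
      rw [le_div_iff₀ (by positivity), mul_comm]
      refine (hb t ⟨h0.trans_lt ht.1, ht.2.trans_le h1⟩).1.trans
        (mul_le_mul_of_nonneg_left ?_ hM)
      linarith [hEt t (abs_le.2 ⟨by linarith [ht.1], by linarith [ht.2]⟩)])
    ⟨by linarith, by linarith⟩ ht
  have hS' : |y t - y s - y1 s * (t - s)| ≤ M * (h ^ 2 + Q * (r ^ 2 * E)) := by
    refine hS.trans ((mul_le_mul_of_nonneg_left hts2 (by positivity)).trans_eq ?_)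
    rw [hrh]
    field_simp
  have hS2 : M * (h ^ 2 + Q * (r ^ 2 * E)) ≤ M * (w * h + Q * (w * (r * E))) := by
    refine mul_le_mul_of_nonneg_left (add_le_add ?_ (mul_le_mul_of_nonneg_left ?_
      (by linarith))) hM
    · nlinarith
    · have := mul_nonneg (sub_nonneg.2 hrw) (mul_nonneg hr0.le hE0)
      linarith
  have hS3 : M * (h ^ 2 + Q * (r ^ 2 * E)) ≤ M * Q * (h ^ 2 + r ^ 2 * E) := by
    have := mul_nonneg (mul_nonneg hM (sq_nonneg h)) (sub_nonneg.2 hQ1)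
    linarith
  have hy1 : |y1 s * (t - s)| ≤ M * (h + r * E) := by
    rw [abs_mul]
    refine (mul_le_mul_of_nonneg_left hts (abs_nonneg _)).trans ?_
    have := mul_le_mul_of_nonneg_left (hb s hs).2 hr0.le
    rw [hrh]
    linarith
  have hdy : |y t - y s| ≤ P * (h + r * E) := by
    have h2 := abs_add_le (y t - y s - y1 s * (t - s)) (y1 s * (t - s))
    rw [sub_add_cancel] at h2
    have hrE : 0 ≤ r * E := mul_nonneg hr0.le hE0
    have h3 : 0 ≤ M * (1 + w) * (Q - 1) * h :=
      mul_nonneg (mul_nonneg (by positivity) (by linarith)) hh.le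
    have h4 : 0 ≤ M * (Q - 1) * (r * E) :=
      mul_nonneg (mul_nonneg hM (by linarith)) hrE
    rw [hP]
    linarith
  have hdy2 : (y t - y s) ^ 2 ≤ 4 * P ^ 2 * (h ^ 2 + r ^ 2 * E) := by
    rw [← sq_abs]
    refine (pow_le_pow_left₀ (abs_nonneg _) hdy 2).trans ?_
    have h2 : (h + r * E) ^ 2 ≤ 4 * (h ^ 2 + r ^ 2 * E) := by
      have := mul_nonneg (mul_nonneg (sq_nonneg r) hE0) (sub_nonneg.2 hE2)
      nlinarith [sq_nonneg (h - r * E), sq_nonneg h]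
    have := mul_le_mul_of_nonneg_left h2 (sq_nonneg P)
    linarith
  have hTay := (hT s hsI (y s) (abs_le.1 (hyM s hsI))).2 t htI (y t) (abs_le.1 (hyM t htI))
  have hfd : |deriv (f s) (y s) - γ| ≤ γ :=
    abs_le.2 ⟨by linarith [hfy s hsI (y s)], by linarith [hγ s hsI (y s)]⟩
  have hdec : f t (y t) - γ * y t - (f s (y s) - γ * y s +
      (fx s (y s) + (deriv (f s) (y s) - γ) * y1 s) * (t - s)) =
      (f t (y t) - f s (y s) - fx s (y s) * (t - s) - deriv (f s) (y s) * (y t - y s)) +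
      (deriv (f s) (y s) - γ) * (y t - y s - y1 s * (t - s)) := by ring
  rw [hdec]
  refine (abs_add_le _ _).trans ?_
  rw [abs_mul, add_mul]
  refine add_le_add (hTay.trans ?_) ?_
  · rw [mul_assoc]
    refine mul_le_mul_of_nonneg_left ?_ hL
    have : 0 ≤ r ^ 2 * E := by positivity
    linarith
  · rw [mul_assoc]
    exact mul_le_mul hfd (hS'.trans hS3) (abs_nonneg _) hγ0.le

/-- The interior residual of the difference scheme, without its scaling factor. -/
noncomputable def schemeResidual (β γ h₀ h₁ u₀ u₁ u₂ F₀ F₁ F₂ : ℝ) : ℝ :=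
  Bcoef β h₀ * u₀ - (Bcoef β h₀ + Bcoef β h₁) * u₁ + Bcoef β h₁ * u₂ -
    (F₀ + F₁) * Acoef β h₀ / γ - (F₁ + F₂) * Acoef β h₁ / γ

theorem exists_residual_bound {f : ℝ → ℝ → ℝ} {m γ : ℝ} {k : ℕ} (hm : 0 < m) (hk : 2 ≤ k)
    (hf : ContDiffOn ℝ k (Function.uncurry f) (Set.Icc 0 1 ×ˢ Set.univ))
    (hfy : ∀ a ∈ Set.Icc (0:ℝ) 1, ∀ u : ℝ, m ≤ deriv (f a) u)
    (hγ : ∀ a ∈ Set.Icc (0:ℝ) 1, ∀ u : ℝ, deriv (f a) u ≤ γ) {w : ℝ} (hw : 0 ≤ w) :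
    ∃ C ≥ (0 : ℝ), ∀ (ε : ℝ) (y y1 y2 : ℝ → ℝ), 0 < ε → ε ≤ 1 / 2 →
      IsClassicalSolution f ε y y1 y2 →
      (∀ x₀ x₁ x₂ H e : ℝ, 0 ≤ x₀ → x₀ < x₁ → x₁ < x₂ → x₂ ≤ 1 → x₁ - x₀ ≤ H → x₂ - x₁ ≤ H →
        (∀ t ∈ Set.Icc x₀ x₂, layer (Real.sqrt m) ε t ≤ e) →
        |schemeResidual (Real.sqrt γ / ε) γ (x₁ - x₀) (x₂ - x₁) (y x₀) (y x₁) (y x₂)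
          (f x₀ (y x₀)) (f x₁ (y x₁)) (f x₂ (y x₂))| ≤
        (Acoef (Real.sqrt γ / ε) (x₁ - x₀) + Acoef (Real.sqrt γ / ε) (x₂ - x₁)) *
          (C * (ε ^ 2 + H ^ 2 + e + |(x₂ - x₁) - (x₁ - x₀)|))) ∧
      (∀ x₀ x₁ x₂ h : ℝ, 0 ≤ x₀ → 0 < h → x₁ - x₀ = h → x₂ - x₁ = h → x₂ ≤ 1 → h ≤ w * ε →
        |schemeResidual (Real.sqrt γ / ε) γ (x₁ - x₀) (x₂ - x₁) (y x₀) (y x₁) (y x₂)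
          (f x₀ (y x₀)) (f x₁ (y x₁)) (f x₂ (y x₂))| ≤
        (Acoef (Real.sqrt γ / ε) (x₁ - x₀) + Acoef (Real.sqrt γ / ε) (x₂ - x₁)) *
          (C * (h ^ 2 + (h / ε) ^ 2 * layer (Real.sqrt m) ε x₁))) := by
  obtain ⟨M, hM, g, G, hg, hsb⟩ := exists_solution_bounds hm hk hf hfy hγ
  obtain ⟨K, hK, hlin⟩ := exists_layer_linearization hm hk hf hfy hγ hM hw
  have hγ0 : 0 < γ := hm.trans_le ((hfy 0 (by simp) 0).trans (hγ 0 (by simp) 0))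
  refine ⟨4 * M / γ + 4 * M + M + 4 * K / γ, by positivity,
    fun ε y y1 y2 hε hε2 hsol => ?_⟩
  obtain ⟨b1, b2⟩ := hsb ε y y1 y2 hε hε2 hsol
  have hA : ∀ h, 0 < h → 0 < Acoef (Real.sqrt γ / ε) h := fun h hh =>
    Acoef_pos (mul_pos (div_pos (Real.sqrt_pos.2 hγ0) hε) hh)
  constructor
  · intro x₀ x₁ x₂ H e h0 h01 h12 h2 hH0 hH1 he
    have hsub : Set.Icc x₀ x₂ ⊆ Set.Icc 0 1 := Set.Icc_subset_Icc h0 h2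
    have hsub' : Set.Ioo x₀ x₂ ⊆ Set.Ioo 0 1 := Set.Ioo_subset_Ioo h0 h2
    have hx₁ : x₁ ∈ Set.Icc x₀ x₂ := ⟨h01.le, h12.le⟩
    have he0 : 0 ≤ e := (layer_nonneg _ _ _).trans (he x₁ hx₁)
    refine (local_truncation (F := fun t => f t (y t)) (c := -γ * g x₁) (D := -γ * G x₁)
      (δ := M * (ε ^ 2 + e) + γ * (M * (ε ^ 2 + e)) + γ * (M * H ^ 2)) h01 h12 hε hγ0 rfl
      (hsol.continuousOn.mono hsub) (hsol.continuousOn_deriv.mono hsub)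
      (fun t ht => hsol.hasDerivAt t (hsub' ht)) (fun t ht => hsol.hasDerivAt_deriv t (hsub' ht))
      (fun t ht => hsol.ode t (hsub' ht)) (fun t ht => ?_)).trans ?_
    · have ht' := hsub ht
      have hd : f t (y t) - γ * y t - (-γ * g x₁ + -γ * G x₁ * (t - x₁)) =
          f t (y t) - γ * (y t - g t) - γ * (g t - g x₁ - G x₁ * (t - x₁)) := by ring
      rw [hd]
      refine (abs_sub _ _).trans (add_le_add ((abs_sub _ _).trans (add_le_add ?_ ?_)) ?_)
      · exact (b1 t ht').2.2.trans (mul_le_mul_of_nonneg_left (by linarith [he t ht]) hM)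
      · rw [abs_mul, abs_of_pos hγ0]
        exact mul_le_mul_of_nonneg_left ((b1 t ht').2.1.trans
          (mul_le_mul_of_nonneg_left (by linarith [he t ht]) hM)) hγ0.le
      · rw [abs_mul, abs_of_pos hγ0]
        refine mul_le_mul_of_nonneg_left (((hg x₁ (hsub hx₁)).2 t ht').trans
          (mul_le_mul_of_nonneg_left ?_ hM)) hγ0.le
        exact sq_le_sq' (by linarith [ht.1]) (by linarith [ht.2])
    · refine mul_le_mul_of_nonneg_left ?_
        (add_pos (hA _ (sub_pos.2 h01)) (hA _ (sub_pos.2 h12))).le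
      have hGb : |-γ * G x₁| ≤ γ * M := by
        rw [abs_mul, abs_neg, abs_of_pos hγ0]
        exact mul_le_mul_of_nonneg_left (hg x₁ (hsub hx₁)).1 hγ0.le
      have hz := abs_nonneg ((x₂ - x₁) - (x₁ - x₀))
      set z := |(x₂ - x₁) - (x₁ - x₀)|
      calc (4 * (M * (ε ^ 2 + e) + γ * (M * (ε ^ 2 + e)) + γ * (M * H ^ 2)) +
            |-γ * G x₁| * z) / γ
          ≤ (4 * (M * (ε ^ 2 + e) + γ * (M * (ε ^ 2 + e)) + γ * (M * H ^ 2)) +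
            γ * M * z) / γ := by gcongr
        _ = 4 * M / γ * (ε ^ 2 + e) + 4 * M * (ε ^ 2 + H ^ 2 + e) + M * z := by
            field_simp
            ring
        _ ≤ _ := by
            have e1 : 0 ≤ 4 * M / γ * (H ^ 2 + z) := by positivity
            have e2 : 0 ≤ 4 * M * z := by positivity
            have e3 : 0 ≤ M * (ε ^ 2 + H ^ 2 + e) := by positivity
            have e4 : 0 ≤ 4 * K / γ * (ε ^ 2 + H ^ 2 + e + z) := by positivity
            linarith
  · intro x₀ x₁ x₂ h h0 hh h01 h12 h2 hhw
    obtain rfl : x₀ = x₁ - h := by linarith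
    obtain rfl : x₂ = x₁ + h := by linarith
    have hsub : Set.Icc (x₁ - h) (x₁ + h) ⊆ Set.Icc 0 1 := Set.Icc_subset_Icc h0 h2
    have hsub' : Set.Ioo (x₁ - h) (x₁ + h) ⊆ Set.Ioo 0 1 := Set.Ioo_subset_Ioo h0 h2
    obtain ⟨D, hD⟩ := hlin ε y y1 y2 hε (by linarith) hsol (fun t ht => (b1 t ht).1) b2 x₁ h hh
      hhw h0 h2
    refine (local_truncation (F := fun t => f t (y t)) (by linarith) (by linarith) hε hγ0 rfl
      (hsol.continuousOn.mono hsub) (hsol.continuousOn_deriv.mono hsub)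
      (fun t ht => hsol.hasDerivAt t (hsub' ht)) (fun t ht => hsol.hasDerivAt_deriv t (hsub' ht))
      (fun t ht => hsol.ode t (hsub' ht)) hD).trans ?_
    rw [h01, h12, sub_self, abs_zero, mul_zero, add_zero]
    refine mul_le_mul_of_nonneg_left ?_ (add_pos (hA _ hh) (hA _ hh)).le
    have hE := layer_nonneg (Real.sqrt m) ε x₁
    set z := h ^ 2 + (h / ε) ^ 2 * layer (Real.sqrt m) ε x₁
    have hz : 0 ≤ z := by positivity
    have e1 : 0 ≤ (4 * M / γ + 4 * M + M) * z := by positivity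
    calc 4 * (K * z) / γ = 4 * K / γ * z := by ring
      _ ≤ _ := by linarith

theorem shishkinPsi_of_le {lam t : ℝ} (h : t ≤ 1 / 4) : shishkinPsi lam t = 4 * lam * t := by
  rw [shishkinPsi, if_pos (h.trans (by norm_num)), if_pos h]

theorem shishkinPsi_of_mem_Icc {lam t : ℝ} (h1 : 1 / 4 ≤ t) (h2 : t ≤ 1 / 2) :
    shishkinPsi lam t = 32 * (1 - 4 * lam) * (t - 1 / 4) ^ 3 + 4 * lam * t := by
  rw [shishkinPsi, if_pos h2]
  split_ifs with h
  · obtain rfl : t = 1 / 4 := le_antisymm h h1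
    ring
  · rfl

theorem shishkinPsi_one_sub (lam t : ℝ) : shishkinPsi lam (1 - t) = 1 - shishkinPsi lam t := by
  rcases lt_trichotomy t (1 / 2) with h | rfl | h
  · rw [shishkinPsi, if_neg (by linarith), shishkinPsi, if_pos h.le, sub_sub_cancel]
  · norm_num [shishkinPsi]
    ring
  · simp only [shishkinPsi]
    rw [if_pos (show 1 - t ≤ 1 / 2 by linarith), if_neg (show ¬t ≤ 1 / 2 by linarith),
      sub_sub_cancel]

/-- The nodes of the modified Shishkin mesh. -/
noncomputable def shishkinMesh (lam : ℝ) (N i : ℕ) : ℝ := shishkinPsi lam ((i : ℝ) / (N : ℝ))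

theorem shishkinMesh_sub {lam : ℝ} {N i : ℕ} (hN : 0 < N) (hi : i ≤ N) :
    shishkinMesh lam N (N - i) = 1 - shishkinMesh lam N i := by
  have : (N : ℝ) ≠ 0 := by positivity
  rw [shishkinMesh, shishkinMesh, ← shishkinPsi_one_sub, Nat.cast_sub hi, sub_div,
    div_self this]

theorem shishkinMesh_zero (lam : ℝ) (N : ℕ) : shishkinMesh lam N 0 = 0 := by
  rw [shishkinMesh, shishkinPsi_of_le] <;> simp

theorem shishkinMesh_last (lam : ℝ) {N : ℕ} (hN : 0 < N) : shishkinMesh lam N N = 1 := by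
  have := shishkinMesh_sub (lam := lam) hN (Nat.zero_le N)
  rwa [shishkinMesh_zero, Nat.sub_zero, sub_zero] at this

/-- The step sizes of the modified Shishkin mesh. -/
noncomputable def shishkinStep (lam : ℝ) (N i : ℕ) : ℝ :=
  shishkinMesh lam N (i + 1) - shishkinMesh lam N i

theorem shishkinStep_symm {lam : ℝ} {N i j : ℕ} (h : i + j + 1 = N) :
    shishkinStep lam N j = shishkinStep lam N i := by
  have hN : 0 < N := by omega
  have h1 := shishkinMesh_sub (lam := lam) hN (show i ≤ N by omega)
  have h2 := shishkinMesh_sub (lam := lam) hN (show i + 1 ≤ N by omega)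
  rw [show N - i = j + 1 by omega] at h1
  rw [show N - (i + 1) = j by omega] at h2
  rw [shishkinStep, shishkinStep, h1, h2]
  ring

theorem shishkinMesh_of_le {lam : ℝ} {n i : ℕ} (hn : 0 < n) (hi : i ≤ n) :
    shishkinMesh lam (4 * n) i = 4 * lam * (i / ((4 * n : ℕ) : ℝ)) := by
  rw [shishkinMesh, shishkinPsi_of_le]
  have : (i : ℝ) ≤ n := by exact_mod_cast hi
  rw [div_le_div_iff₀ (by positivity) (by norm_num)]
  push_cast
  linarith

theorem shishkinMesh_of_le_two_mul {lam : ℝ} {n i : ℕ} (hn : 0 < n) (h1 : n ≤ i)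
    (h2 : i ≤ 2 * n) :
    shishkinMesh lam (4 * n) i =
      32 * (1 - 4 * lam) * ((i : ℝ) / ((4 * n : ℕ) : ℝ) - 1 / 4) ^ 3 +
        4 * lam * (i / ((4 * n : ℕ) : ℝ)) := by
  have : (n : ℝ) ≤ i := by exact_mod_cast h1
  have : (i : ℝ) ≤ 2 * n := by exact_mod_cast h2
  rw [shishkinMesh, shishkinPsi_of_mem_Icc]
  · rw [div_le_div_iff₀ (by norm_num) (by positivity)]
    push_cast
    linarith
  · rw [div_le_div_iff₀ (by positivity) (by norm_num)]
    push_cast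
    linarith

theorem shishkinStep_of_lt {lam : ℝ} {n i : ℕ} (hn : 0 < n) (hi : i < n) :
    shishkinStep lam (4 * n) i = 4 * lam / ((4 * n : ℕ) : ℝ) := by
  rw [shishkinStep, shishkinMesh_of_le hn hi, shishkinMesh_of_le hn hi.le]
  push_cast
  ring

theorem shishkinStep_add {lam : ℝ} {n j : ℕ} (hj : j < n) :
    shishkinStep lam (4 * n) (n + j) = 4 * lam / ((4 * n : ℕ) : ℝ) +
      32 * (1 - 4 * lam) * (3 * j ^ 2 + 3 * j + 1) / ((4 * n : ℕ) : ℝ) ^ 3 := by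
  have hn : 0 < n := by omega
  have hn' : (n : ℝ) ≠ 0 := by positivity
  rw [shishkinStep, shishkinMesh_of_le_two_mul hn (by omega) (by omega),
    shishkinMesh_of_le_two_mul hn (by omega) (by omega)]
  push_cast
  field_simp
  ring

theorem shishkinStep_bounds {lam : ℝ} {n i : ℕ} (h0 : 0 ≤ lam) (h1 : lam ≤ 1 / 4)
    (hi : i < 4 * n) :
    4 * lam / ((4 * n : ℕ) : ℝ) ≤ shishkinStep lam (4 * n) i ∧
      shishkinStep lam (4 * n) i ≤ 7 / ((4 * n : ℕ) : ℝ) := by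
  wlog hin : i < 2 * n generalizing i
  · have := this (i := 4 * n - 1 - i) (by omega) (by omega)
    rwa [shishkinStep_symm (i := i) (by omega)] at this
  have hn : 0 < n := by omega
  have hN : (0 : ℝ) < ((4 * n : ℕ) : ℝ) := by positivity
  rcases lt_or_ge i n with h | h
  · rw [shishkinStep_of_lt hn h]
    exact ⟨le_rfl, by gcongr; linarith⟩
  obtain ⟨j, rfl⟩ := Nat.exists_eq_add_of_le h
  have hj : j < n := by omega
  have hj' : ((j : ℝ) + 1) ≤ n := by exact_mod_cast hj
  have hj0 : (0 : ℝ) ≤ j := by positivity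
  have hl : 0 ≤ 1 - 4 * lam := by linarith
  rw [shishkinStep_add hj]
  constructor
  · have : 0 ≤ 32 * (1 - 4 * lam) * (3 * (j : ℝ) ^ 2 + 3 * j + 1) / ((4 * n : ℕ) : ℝ) ^ 3 := by
      positivity
    linarith
  · have hsq : 3 * (j : ℝ) ^ 2 + 3 * j + 1 ≤ 3 * n ^ 2 := by nlinarith
    have h2 : 32 * (1 - 4 * lam) * (3 * (j : ℝ) ^ 2 + 3 * j + 1) / ((4 * n : ℕ) : ℝ) ^ 3 ≤
        32 * 1 * (3 * (n : ℝ) ^ 2) / ((4 * n : ℕ) : ℝ) ^ 3 := by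
      gcongr
      linarith
    have h3 : 32 * 1 * (3 * (n : ℝ) ^ 2) / ((4 * n : ℕ) : ℝ) ^ 3 = 6 / ((4 * n : ℕ) : ℝ) := by
      have : (n : ℝ) ≠ 0 := by positivity
      push_cast
      field_simp
      norm_num
    have h4 : 4 * lam / ((4 * n : ℕ) : ℝ) ≤ 1 / ((4 * n : ℕ) : ℝ) := by gcongr; linarith
    have h5 : (7 : ℝ) / ((4 * n : ℕ) : ℝ) = 6 / ((4 * n : ℕ) : ℝ) + 1 / ((4 * n : ℕ) : ℝ) := by ring
    linarith

theorem shishkinStep_of_ge {lam : ℝ} {n i : ℕ} (h : 3 * n ≤ i) (hi : i < 4 * n) :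
    shishkinStep lam (4 * n) i = 4 * lam / ((4 * n : ℕ) : ℝ) := by
  rw [shishkinStep_symm (j := i) (i := 4 * n - 1 - i) (by omega),
    shishkinStep_of_lt (by omega) (by omega)]

theorem abs_shishkinStep_sub_le {lam : ℝ} {n i : ℕ} (h0 : 0 ≤ lam) (h1 : lam ≤ 1 / 4)
    (hi : i + 1 < 4 * n) :
    |shishkinStep lam (4 * n) (i + 1) - shishkinStep lam (4 * n) i| ≤
      48 / ((4 * n : ℕ) : ℝ) ^ 2 := by
  wlog hin : i + 1 ≤ 2 * n generalizing i
  · have := this (i := 4 * n - 2 - i) (by omega) (by omega)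
    rwa [shishkinStep_symm (i := i) (j := 4 * n - 2 - i + 1) (by omega),
      shishkinStep_symm (i := i + 1) (j := 4 * n - 2 - i) (by omega), abs_sub_comm] at this
  have hn : 0 < n := by omega
  have hN : (0 : ℝ) < ((4 * n : ℕ) : ℝ) := by positivity
  have hl : 0 ≤ 1 - 4 * lam := by linarith
  rcases eq_or_lt_of_le hin with h | h
  · rw [shishkinStep_symm (j := i + 1) (i := i) (by omega), sub_self, abs_zero]
    positivity
  rcases lt_or_ge (i + 1) n with h2 | h2
  · rw [shishkinStep_of_lt hn h2, shishkinStep_of_lt hn (by omega), sub_self, abs_zero]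
    positivity
  have key : ∀ c : ℝ, 0 ≤ c → c ≤ 6 * n →
      |32 * (1 - 4 * lam) * c / ((4 * n : ℕ) : ℝ) ^ 3| ≤ 48 / ((4 * n : ℕ) : ℝ) ^ 2 := by
    intro c hc0 hc
    rw [abs_of_nonneg (by positivity)]
    have h3 : 32 * (1 - 4 * lam) * c / ((4 * n : ℕ) : ℝ) ^ 3 ≤
        32 * 1 * (6 * n) / ((4 * n : ℕ) : ℝ) ^ 3 := by
      gcongr
      linarith
    refine h3.trans_eq ?_
    have : (n : ℝ) ≠ 0 := by positivity
    push_cast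
    field_simp
    norm_num
  rcases eq_or_lt_of_le h2 with h3 | h3
  · have e : i + 1 = n + 0 := by omega
    rw [e, shishkinStep_add hn, shishkinStep_of_lt hn (by omega)]
    have hn1 : (1 : ℝ) ≤ n := by exact_mod_cast hn
    convert key 1 zero_le_one (by linarith) using 2
    push_cast
    ring
  · obtain ⟨j, rfl⟩ := Nat.exists_eq_add_of_le (show n ≤ i by omega)
    have hj' : ((j : ℝ) + 1) ≤ n := by exact_mod_cast (show j + 1 ≤ n by omega)
    rw [add_assoc, shishkinStep_add (show j + 1 < n by omega), shishkinStep_add (by omega)]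
    convert key (6 * (j + 1)) (by positivity) (by linarith) using 2
    push_cast
    ring

theorem shishkinMesh_mono {lam : ℝ} {n i j : ℕ} (h0 : 0 ≤ lam) (h1 : lam ≤ 1 / 4)
    (hij : i ≤ j) (hj : j ≤ 4 * n) : shishkinMesh lam (4 * n) i ≤ shishkinMesh lam (4 * n) j := by
  induction j, hij using Nat.le_induction with
  | base => exact le_rfl
  | succ j _ ih =>
    have h2 := (shishkinStep_bounds (n := n) (i := j) h0 h1 (by omega)).1
    have h3 : 0 ≤ 4 * lam / ((4 * n : ℕ) : ℝ) := by positivity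
    rw [shishkinStep] at h2
    linarith [ih (by omega)]

theorem shishkinMesh_transition {lam : ℝ} {n : ℕ} (hn : 0 < n) :
    shishkinMesh lam (4 * n) n = lam ∧ shishkinMesh lam (4 * n) (3 * n) = 1 - lam := by
  have h : shishkinMesh lam (4 * n) n = lam := by
    have : (n : ℝ) ≠ 0 := by positivity
    rw [shishkinMesh_of_le hn le_rfl]
    push_cast
    field_simp
  refine ⟨h, ?_⟩
  have h2 := shishkinMesh_sub (lam := lam) (N := 4 * n) (i := n) (by omega) (by omega)
  rwa [show 4 * n - n = 3 * n by omega, h] at h2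

theorem layer_le_of_mem_Icc {a ε t r : ℝ} {N : ℕ} (ha : 0 ≤ a) (hε : 0 < ε) (hN : 0 < N)
    (h : a * r = 2 * ε * Real.log N - 8 * ε) (ht : t ∈ Set.Icc r (1 - r)) :
    layer a ε t ≤ 2 * Real.exp 8 / (N : ℝ) ^ 2 := by
  have hN' : (0 : ℝ) < N := by exact_mod_cast hN
  have key : ∀ s, r ≤ s → Real.exp (-(a * s / ε)) ≤ Real.exp 8 / (N : ℝ) ^ 2 := by
    intro s hs
    have e : Real.exp 8 / (N : ℝ) ^ 2 = Real.exp (8 - 2 * Real.log N) := by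
      rw [Real.exp_sub, show 2 * Real.log N = ((2 : ℕ) : ℝ) * Real.log N by norm_num,
        Real.exp_nat_mul, Real.exp_log hN']
    rw [e, Real.exp_le_exp, neg_le, le_div_iff₀ hε]
    nlinarith [mul_le_mul_of_nonneg_left hs ha]
  have h1 := key t ht.1
  have h2 := key (1 - t) (by linarith [ht.2])
  rw [layer, show 2 * Real.exp 8 / (N : ℝ) ^ 2 =
    Real.exp 8 / (N : ℝ) ^ 2 + Real.exp 8 / (N : ℝ) ^ 2 by ring]
  exact add_le_add h1 h2

theorem linOp_eq_schemeResidual_sub {β γ : ℝ} (hγ : γ ≠ 0) {h d u v F G e A B : ℕ → ℝ} (i : ℕ)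
    (hA : ∀ j, A j = Acoef β (h j)) (hB : ∀ j, B j = Bcoef β (h j)) (he : ∀ j, e j = u j - v j)
    (h0 : F i - G i = γ * d i * e i)
    (h1 : F (i + 1) - G (i + 1) = γ * d (i + 1) * e (i + 1))
    (h2 : F (i + 2) - G (i + 2) = γ * d (i + 2) * e (i + 2)) :
    linOp A B d e i =
      schemeResidual β γ (h i) (h (i + 1)) (u i) (u (i + 1)) (u (i + 2)) (F i) (F (i + 1))
        (F (i + 2)) -
      schemeResidual β γ (h i) (h (i + 1)) (v i) (v (i + 1)) (v (i + 2)) (G i) (G (i + 1))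
        (G (i + 2)) := by
  rw [sub_eq_iff_eq_add] at h0 h1 h2
  rw [linOp, schemeResidual, schemeResidual, h0, h1, h2, ← hA, ← hA, ← hB, ← hB]
  simp only [he]
  field_simp
  ring

theorem schemeResidual_eq_zero_of_Tdisc_eq_zero {f : ℝ → ℝ → ℝ} {γ β : ℝ} {x u : ℕ → ℝ} {N i : ℕ}
    (hγ : 0 < γ) (hA : ∀ j < N, 0 < Acoef β (x (j + 1) - x j)) (hi : i + 1 < N)
    (h : Tdisc f γ β x N u (i + 1) = 0) :
    schemeResidual β γ (x (i + 1) - x i) (x (i + 2) - x (i + 1)) (u i) (u (i + 1)) (u (i + 2))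
      (f (x i) (u i)) (f (x (i + 1)) (u (i + 1))) (f (x (i + 2)) (u (i + 2))) = 0 := by
  rw [Tdisc, if_neg (by omega)] at h
  have h1 := hA i (by omega)
  have h2 := hA (i + 1) hi
  have hpos : 0 < γ / (Acoef β (x (i + 1) - x i) + Acoef β (x (i + 1 + 1) - x (i + 1))) := by
    positivity
  exact (mul_eq_zero.1 h).resolve_left hpos.ne'

theorem exists_barrier_error_bound {f : ℝ → ℝ → ℝ} {m γ : ℝ} {k : ℕ} (hm : 0 < m) (hk : 2 ≤ k)
    (hf : ContDiffOn ℝ k (Function.uncurry f) (Set.Icc 0 1 ×ˢ Set.univ))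
    (hfy : ∀ a ∈ Set.Icc (0:ℝ) 1, ∀ u : ℝ, m ≤ deriv (f a) u)
    (hγ : ∀ a ∈ Set.Icc (0:ℝ) 1, ∀ u : ℝ, deriv (f a) u ≤ γ) :
    ∃ C ≥ (0 : ℝ), ∀ (ε lam : ℝ) (n : ℕ) (y y1 y2 : ℝ → ℝ) (ybar : ℕ → ℝ), 0 < n → 0 < ε →
      ε ≤ 1 / (4 * n : ℕ) → IsClassicalSolution f ε y y1 y2 →
      lam = 2 * ε * Real.log (4 * n : ℕ) / Real.sqrt m → lam ≤ 1 / 4 →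
      (∀ i ≤ 4 * n,
        Tdisc f γ (Real.sqrt γ / ε) (shishkinMesh lam (4 * n)) (4 * n) ybar i = 0) →
      ∀ i ≤ 4 * n, |y (shishkinMesh lam (4 * n) i) - ybar i| ≤
        C / ((4 * n : ℕ) : ℝ) ^ 2 + C * Real.log (4 * n : ℕ) ^ 2 / ((4 * n : ℕ) : ℝ) ^ 2 *
          (leftBarrier (Real.sqrt m / (2 * Real.sqrt γ))
            (fun j => Acoef (Real.sqrt γ / ε) (shishkinStep lam (4 * n) j)) i +
          rightBarrier (Real.sqrt m / (2 * Real.sqrt γ))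
            (fun j => Acoef (Real.sqrt γ / ε) (shishkinStep lam (4 * n) j)) (4 * n) i) := by
  have hmγ : m ≤ γ := (hfy 0 (by simp) 0).trans (hγ 0 (by simp) 0)
  have hγ0 : 0 < γ := hm.trans_le hmγ
  have hsm : 0 < Real.sqrt m := Real.sqrt_pos.2 hm
  have hsγ : 0 < Real.sqrt γ := Real.sqrt_pos.2 hγ0
  obtain ⟨K, hK, hres⟩ := exists_residual_bound hm hk hf hfy hγ
    (w := 8 / Real.sqrt m) (by positivity)
  set μ := m / γ with hμdef
  have hμ : 0 < μ := by positivity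
  have hμ1 : μ ≤ 1 := (div_le_one hγ0).2 hmγ
  set S := 98 + 2 * Real.exp 8 + 64 / m with hS
  have hS0 : 0 < S := by positivity
  refine ⟨K * S / μ, by positivity, fun ε lam n y y1 y2 ybar hn hε hεN hsol hlam hlam4 hT => ?_⟩
  set N := 4 * n with hNdef
  have hN1 : (1 : ℝ) ≤ N := by exact_mod_cast (show 1 ≤ N by omega)
  have hN0 : (0 : ℝ) < N := by linarith
  have hN4 : (4 : ℝ) ≤ N := by exact_mod_cast (show 4 ≤ N by omega)
  have hlog0 : 0 < Real.log N := Real.log_pos (by linarith)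
  have hlogN : Real.log N ≤ N := (Real.log_le_sub_one_of_pos hN0).trans (by linarith)
  have hε4 : ε ≤ 1 / 2 := hεN.trans (one_div_le_one_div_of_le (by norm_num) (by linarith))
  have hlam0 : 0 < lam := by rw [hlam]; positivity
  obtain ⟨r1, r2⟩ := hres ε y y1 y2 hε hε4 hsol
  set x := shishkinMesh lam N with hx
  set h := shishkinStep lam N with hh
  have hstep : ∀ i, x (i + 1) - x i = h i := fun i => rfl
  set β := Real.sqrt γ / ε with hβ
  have hβ0 : 0 < β := by positivity
  have hb : ∀ i < N, 4 * lam / N ≤ h i ∧ h i ≤ 7 / N := fun i hi =>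
    shishkinStep_bounds hlam0.le hlam4 hi
  have hpos : ∀ i < N, 0 < h i := fun i hi => lt_of_lt_of_le (by positivity) (hb i hi).1
  have hmono : ∀ i j, i ≤ j → j ≤ N → x i ≤ x j := fun i j h1 h2 =>
    shishkinMesh_mono hlam0.le hlam4 h1 h2
  have hx0 : x 0 = 0 := shishkinMesh_zero _ _
  have hxN : x N = 1 := shishkinMesh_last _ (by omega)
  have hxI : ∀ i ≤ N, x i ∈ Set.Icc (0 : ℝ) 1 := fun i hi =>
    ⟨hx0 ▸ hmono 0 i (by omega) hi, hxN ▸ hmono i N hi le_rfl⟩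
  set A : ℕ → ℝ := fun j => Acoef β (h j) with hAdef
  have hβh : ∀ i < N, 0 < β * h i := fun i hi => mul_pos hβ0 (hpos i hi)
  have hA : ∀ i < N, 0 < A i := fun i hi => Acoef_pos (hβh i hi)
  have hA1 : ∀ i < N, A i ≤ 1 := fun i hi => Acoef_le_one (hβh i hi)
  set κ := Real.sqrt m / (2 * Real.sqrt γ) with hκdef
  have hκ0 : 0 ≤ κ := by positivity
  have hκ2 : κ ≤ 1 / 2 := by
    rw [hκdef, div_le_div_iff₀ (by positivity) (by norm_num)]
    linarith [Real.sqrt_le_sqrt hmγ]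
  have hκμ : κ ^ 2 ≤ μ := by
    have : κ ^ 2 = μ / 4 := by
      rw [hκdef, div_pow, mul_pow, Real.sq_sqrt hm.le, Real.sq_sqrt hγ0.le, hμdef]
      field_simp
      norm_num
    linarith
  have hκA : ∀ i < N, κ * A i ≤ 1 := fun i hi => by nlinarith [hA i hi, hA1 i hi]
  have hex : ∀ i, ∃ d, μ ≤ d ∧ d ≤ 1 ∧
      (i ≤ N → f (x i) (y (x i)) - f (x i) (ybar i) = γ * d * (y (x i) - ybar i)) := by
    intro i
    by_cases hi : i ≤ N
    · obtain ⟨d, d1, d2, hd⟩ := exists_slope hm (hfy _ (hxI i hi)) (hγ _ (hxI i hi)) (y (x i))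
        (ybar i)
      refine ⟨d / γ, div_le_div_of_nonneg_right d1 hγ0.le, (div_le_one hγ0).2 d2, fun _ => ?_⟩
      rw [hd, mul_div_cancel₀ _ hγ0.ne']
    · exact ⟨1, hμ1, le_rfl, fun h => absurd h hi⟩
  choose d hd hd1 hde using hex
  have hlayer : ∀ i ≤ N, layer (Real.sqrt m) ε (x i) ≤
      leftBarrier κ A i + rightBarrier κ A N i := by
    intro i hi
    have hκβ : κ * β = Real.sqrt m / ε / 2 := by
      rw [hκdef, hβ]
      field_simp
    have hhalf : ∀ j < N, A j ≤ β * (x (j + 1) - x j) / 2 := fun j hj =>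
      Acoef_le_half (hβh j hj)
    have h1 := exp_le_leftBarrier (x := x) (β := β) (i := i) hκ0 hκ2
      (fun j hj => (hA j (by omega)).le) (fun j hj => hA1 j (by omega))
      (fun j hj => hhalf j (by omega))
    have h2 := exp_le_rightBarrier (x := x) (β := β) hκ0 hκ2
      (fun j hj => (hA j hj).le) hA1 hhalf hi
    have hexp : ∀ s, 0 ≤ s → Real.exp (-(Real.sqrt m * s / ε)) ≤ Real.exp (-(κ * β * s)) := by
      intro s hs
      rw [Real.exp_le_exp, hκβ]
      have : 0 ≤ Real.sqrt m * s / ε := by positivity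
      rw [show Real.sqrt m / ε / 2 * s = Real.sqrt m * s / ε / 2 by ring]
      linarith
    rw [hx0, sub_zero] at h1
    rw [hxN] at h2
    exact add_le_add ((hexp _ (hxI i hi).1).trans h1)
      ((hexp _ (sub_nonneg.2 (hxI i hi).2)).trans h2)
  have hc₁ : 0 ≤ K * S / μ / (N : ℝ) ^ 2 := by positivity
  have hc₂ : 0 ≤ K * S / μ * Real.log N ^ 2 / (N : ℝ) ^ 2 := by positivity
  refine abs_le_barrier (A := A) (B := fun j => Bcoef β (h j)) (d := d) (μ := μ) hA hA1
    (fun i hi => Bcoef_mul_Acoef (hβh i hi)) hd hd1 hμ hκ0 (by linarith) hκμ hc₁ hc₂ ?_ ?_ ?_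
  · have := hT 0 (by omega)
    rw [Tdisc, if_pos (Or.inl rfl), neg_eq_zero] at this
    rw [hx0, hsol.left, this, sub_zero]
  · have := hT N le_rfl
    rw [Tdisc, if_pos (Or.inr rfl), neg_eq_zero] at this
    rw [hxN, hsol.right, this, sub_zero]
  intro i hi
  rw [linOp_eq_schemeResidual_sub (β := β) (h := h) hγ0.ne' (u := fun j => y (x j)) (v := ybar)
    (F := fun j => f (x j) (y (x j))) (G := fun j => f (x j) (ybar j)) i (fun _ => rfl)
    (fun _ => rfl) (fun _ => rfl) (hde i (by omega)) (hde (i + 1) (by omega))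
    (hde (i + 2) (by omega)),
    show schemeResidual β γ (h i) (h (i + 1)) (ybar i) (ybar (i + 1)) (ybar (i + 2))
      (f (x i) (ybar i)) (f (x (i + 1)) (ybar (i + 1))) (f (x (i + 2)) (ybar (i + 2))) = 0 from
      schemeResidual_eq_zero_of_Tdisc_eq_zero hγ0 hA hi (hT (i + 1) hi.le), sub_zero]
  have hAA : 0 < A i + A (i + 1) := add_pos (hA i (by omega)) (hA (i + 1) hi)
  have hbar : 0 ≤ leftBarrier κ A (i + 1) + rightBarrier κ A N (i + 1) :=
    add_nonneg (leftBarrier_nonneg hκA hi.le) (rightBarrier_nonneg hκA)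
  set b := leftBarrier κ A (i + 1) + rightBarrier κ A N (i + 1) with hbdef
  have hrhs : μ * (A i + A (i + 1)) * (K * S / μ / (N : ℝ) ^ 2 +
      K * S / μ * Real.log N ^ 2 / (N : ℝ) ^ 2 * b) = (A i + A (i + 1)) *
      (K * (S * (1 + Real.log N ^ 2 * b) / (N : ℝ) ^ 2)) := by
    field_simp
  rw [hrhs]
  have h01 := hpos i (by omega)
  have h12 := hpos (i + 1) hi
  by_cases hmid : n ≤ i + 1 ∧ i + 1 ≤ 3 * n
  · have htr := shishkinMesh_transition (lam := lam) hn
    have hl : x (n - 1) = lam - 4 * lam / N := by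
      have := shishkinStep_of_lt (lam := lam) hn (show n - 1 < n by omega)
      rw [shishkinStep, show n - 1 + 1 = n by omega, htr.1] at this
      rw [hx, hNdef]
      linarith
    have hr : x (3 * n + 1) = 1 - (lam - 4 * lam / N) := by
      have := shishkinStep_of_ge (lam := lam) (le_refl (3 * n)) (by omega)
      rw [shishkinStep, htr.2] at this
      rw [hx, hNdef]
      linarith
    have e1 := r1 (x i) (x (i + 1)) (x (i + 2)) (7 / N) (2 * Real.exp 8 / (N : ℝ) ^ 2)
      (hxI i (by omega)).1 (sub_pos.1 h01) (sub_pos.1 h12) (hxI (i + 2) (by omega)).2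
      (hb i (by omega)).2 (hb (i + 1) hi).2 (fun t ht => by
        refine layer_le_of_mem_Icc (r := 2 * ε * (Real.log N - 4) / Real.sqrt m) hsm.le hε
          (by omega) (by field_simp; ring) ?_
        have hle : 2 * ε * (Real.log N - 4) / Real.sqrt m ≤ lam - 4 * lam / N := by
          rw [hlam]
          have h3 : 2 * ε / Real.sqrt m * (Real.log N / N) ≤ 2 * ε / Real.sqrt m * 1 :=
            mul_le_mul_of_nonneg_left ((div_le_one hN0).2 hlogN) (by positivity)
          have h4 : 2 * ε * Real.log N / Real.sqrt m - 4 * (2 * ε * Real.log N / Real.sqrt m) / N -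
            2 * ε * (Real.log N - 4) / Real.sqrt m =
            4 * (2 * ε / Real.sqrt m * 1 - 2 * ε / Real.sqrt m * (Real.log N / N)) := by ring
          linarith
        have h5 := hmono (n - 1) i (by omega) (by omega)
        have h6 := hmono (i + 2) (3 * n + 1) (by omega) (by omega)
        exact ⟨by linarith [ht.1], by linarith [ht.2]⟩)
    refine e1.trans (mul_le_mul_of_nonneg_left (mul_le_mul_of_nonneg_left ?_ hK) hAA.le)
    have e2 : |(x (i + 2) - x (i + 1)) - (x (i + 1) - x i)| ≤ 48 / (N : ℝ) ^ 2 :=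
      abs_shishkinStep_sub_le hlam0.le hlam4 hi
    have e3 : ε ^ 2 ≤ 1 / (N : ℝ) ^ 2 := by
      have := pow_le_pow_left₀ hε.le hεN 2
      rwa [div_pow, one_pow] at this
    have e4 : S * (1 + Real.log N ^ 2 * b) / (N : ℝ) ^ 2 = 1 / (N : ℝ) ^ 2 + (7 / N) ^ 2 +
        2 * Real.exp 8 / (N : ℝ) ^ 2 + 48 / (N : ℝ) ^ 2 +
        (64 / m + S * (Real.log N ^ 2 * b)) / (N : ℝ) ^ 2 := by
      rw [hS]
      ring
    have e5 : 0 ≤ (64 / m + S * (Real.log N ^ 2 * b)) / (N : ℝ) ^ 2 := by positivity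
    linarith
  · have hunif : h i = 4 * lam / N ∧ h (i + 1) = 4 * lam / N := by
      rcases lt_or_ge (i + 1) n with h3 | h3
      · exact ⟨shishkinStep_of_lt hn (by omega), shishkinStep_of_lt hn h3⟩
      · exact ⟨shishkinStep_of_ge (by omega) (by omega), shishkinStep_of_ge (by omega) (by omega)⟩
    have hhε : 4 * lam / N / ε = 8 / Real.sqrt m * (Real.log N / N) := by
      rw [hlam]
      field_simp
      norm_num
    have e1 := r2 (x i) (x (i + 1)) (x (i + 2)) (4 * lam / N) (hxI i (by omega)).1
      (by positivity) hunif.1 hunif.2 (hxI (i + 2) (by omega)).2 (by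
        rw [← div_le_iff₀ hε, hhε]
        exact mul_le_of_le_one_right (by positivity) ((div_le_one hN0).2 hlogN))
    refine e1.trans (mul_le_mul_of_nonneg_left (mul_le_mul_of_nonneg_left ?_ hK) hAA.le)
    have e2 : (4 * lam / N) ^ 2 ≤ 49 / (N : ℝ) ^ 2 := by
      have := pow_le_pow_left₀ (by positivity) ((hb i (by omega)).1.trans (hb i (by omega)).2) 2
      rw [div_pow 7] at this
      norm_num at this
      exact this
    have e3 : (4 * lam / N / ε) ^ 2 = 64 / m * (Real.log N ^ 2 / (N : ℝ) ^ 2) := by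
      rw [hhε, mul_pow, div_pow, div_pow, Real.sq_sqrt hm.le]
      norm_num
    rw [e3]
    have e4 : 64 / m * (Real.log N ^ 2 / (N : ℝ) ^ 2) * layer (Real.sqrt m) ε (x (i + 1)) ≤
        64 / m * (Real.log N ^ 2 / (N : ℝ) ^ 2) * b :=
      mul_le_mul_of_nonneg_left (hlayer (i + 1) hi.le) (by positivity)
    have e5 : S * (1 + Real.log N ^ 2 * b) / (N : ℝ) ^ 2 = 49 / (N : ℝ) ^ 2 +
        64 / m * (Real.log N ^ 2 / (N : ℝ) ^ 2) * b + (49 + 2 * Real.exp 8 + 64 / m +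
        (98 + 2 * Real.exp 8) * (Real.log N ^ 2 * b)) / (N : ℝ) ^ 2 := by
      rw [hS]
      ring
    have e6 : 0 ≤ (49 + 2 * Real.exp 8 + 64 / m +
        (98 + 2 * Real.exp 8) * (Real.log N ^ 2 * b)) / (N : ℝ) ^ 2 := by positivity
    linarith

theorem barrier_le {A : ℕ → ℝ} {κ a : ℝ} {n N i : ℕ} (hκ0 : 0 ≤ κ)
    (hA : ∀ j < N, 0 ≤ A j) (hA1 : ∀ j < N, κ * A j ≤ 1)
    (ha : ∀ j < N, j < n ∨ N ≤ j + n → a ≤ A j) (h1 : n ≤ i) (h2 : i + n ≤ N) :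
    leftBarrier κ A i + rightBarrier κ A N i ≤ 2 * Real.exp (-(κ * a * n)) := by
  have hl := leftBarrier_le_exp (a := a) hκ0 (fun j hj => hA j (by omega))
    (fun j hj => hA1 j (by omega)) (fun j hj => ha j (by omega) (Or.inl hj)) h1
  have hr := rightBarrier_le_exp (a := a) hκ0 hA hA1 (fun j hj h => ha j hj (Or.inr h)) h2
  linarith

theorem sq_mul_exp_neg_le {c z : ℝ} (hc : 0 < c) (hz : 0 ≤ z) :
    z ^ 2 * Real.exp (-(c * z)) ≤ 2 / c ^ 2 := by
  have h := Real.quadratic_le_exp_of_nonneg (mul_nonneg hc.le hz)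
  have h0 := mul_nonneg hc.le hz
  rw [Real.exp_neg, ← div_eq_mul_inv, div_le_div_iff₀ (Real.exp_pos _) (by positivity)]
  nlinarith

theorem exists_shishkin_error_bound {f : ℝ → ℝ → ℝ} {m γ : ℝ} {k : ℕ} (hm : 0 < m) (hk : 2 ≤ k)
    (hf : ContDiffOn ℝ k (Function.uncurry f) (Set.Icc 0 1 ×ˢ Set.univ))
    (hfy : ∀ a ∈ Set.Icc (0:ℝ) 1, ∀ u : ℝ, m ≤ deriv (f a) u)
    (hγ : ∀ a ∈ Set.Icc (0:ℝ) 1, ∀ u : ℝ, deriv (f a) u ≤ γ) :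
    ∃ C > (0 : ℝ), ∀ (ε lam : ℝ) (n : ℕ) (y y1 y2 : ℝ → ℝ) (ybar : ℕ → ℝ), 0 < n → 0 < ε →
      ε ≤ 1 / (4 * n : ℕ) → IsClassicalSolution f ε y y1 y2 →
      lam = 2 * ε * Real.log (4 * n : ℕ) / Real.sqrt m → lam ≤ 1 / 4 →
      (∀ i ≤ 4 * n,
        Tdisc f γ (Real.sqrt γ / ε) (shishkinMesh lam (4 * n)) (4 * n) ybar i = 0) →
      ∀ i ≤ 4 * n,
        |y (shishkinMesh lam (4 * n) i) - ybar i| ≤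
          C * Real.log (4 * n : ℕ) ^ 2 / ((4 * n : ℕ) : ℝ) ^ 2 ∧
        (n ≤ i → i ≤ 3 * n → |y (shishkinMesh lam (4 * n) i) - ybar i| ≤
          C / ((4 * n : ℕ) : ℝ) ^ 2) := by
  have hmγ : m ≤ γ := (hfy 0 (by simp) 0).trans (hγ 0 (by simp) 0)
  have hγ0 : 0 < γ := hm.trans_le hmγ
  have hsm : 0 < Real.sqrt m := Real.sqrt_pos.2 hm
  have hsγ : 0 < Real.sqrt γ := Real.sqrt_pos.2 hγ0
  obtain ⟨K, hK, hbar⟩ := exists_barrier_error_bound hm hk hf hfy hγ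
  set q := 4 * Real.sqrt γ / Real.sqrt m with hq
  set c := 1 / (2 * Real.cosh q) with hc
  have hcosh : 0 < Real.cosh q := Real.cosh_pos q
  have hc0 : 0 < c := by positivity
  refine ⟨3 * K + 4 * K / c ^ 2 + 1, by positivity,
    fun ε lam n y y1 y2 ybar hn hε hεN hsol hlam hlam4 hT i hi => ?_⟩
  have he := hbar ε lam n y y1 y2 ybar hn hε hεN hsol hlam hlam4 hT i hi
  set N := 4 * n with hNdef
  have hNn : (N : ℝ) = 4 * n := by rw [hNdef]; push_cast; ring
  have hN4 : (4 : ℝ) ≤ N := by exact_mod_cast (show 4 ≤ N by omega)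
  have hN0 : (0 : ℝ) < N := by linarith
  have hlog1 : 1 ≤ Real.log N := by
    rw [Real.le_log_iff_exp_le hN0]
    linarith [Real.exp_one_lt_d9]
  have hlogN : Real.log N ≤ N := (Real.log_le_sub_one_of_pos hN0).trans (by linarith)
  have hlam0 : 0 < lam := by rw [hlam]; positivity
  set h := shishkinStep lam N
  set β := Real.sqrt γ / ε with hβ
  have hβ0 : 0 < β := by positivity
  have hβh : ∀ i < N, 0 < β * h i := fun i hi =>
    mul_pos hβ0 (lt_of_lt_of_le (by positivity) (shishkinStep_bounds hlam0.le hlam4 hi).1)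
  set A : ℕ → ℝ := fun j => Acoef β (h j)
  have hA : ∀ i < N, 0 ≤ A i := fun i hi => (Acoef_pos (hβh i hi)).le
  set κ := Real.sqrt m / (2 * Real.sqrt γ) with hκ
  have hκ0 : 0 ≤ κ := by positivity
  have hκ1 : κ ≤ 1 := by
    rw [hκ, div_le_one (by positivity)]
    linarith [Real.sqrt_le_sqrt hmγ]
  have hκA : ∀ i < N, κ * A i ≤ 1 := fun i hi =>
    (mul_le_mul hκ1 (Acoef_le_one (hβh i hi)) (hA i hi) zero_le_one).trans_eq (one_mul 1)
  set b := leftBarrier κ A i + rightBarrier κ A N i with hb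
  have hlay : K * Real.log N ^ 2 / (N : ℝ) ^ 2 * b = K * (Real.log N ^ 2 * b) / (N : ℝ) ^ 2 := by
    ring
  rw [hlay, ← add_div] at he
  have hKc : 0 ≤ K / c ^ 2 := by positivity
  constructor
  · have hb2 : b ≤ 2 := by
      have := barrier_le (a := 0) (n := 0) (i := i) hκ0 hA hκA (fun j hj _ => hA j hj)
        (Nat.zero_le _) hi
      simpa using this
    refine he.trans (div_le_div_of_nonneg_right ?_ (by positivity))
    have hsq : 1 ≤ Real.log N ^ 2 := one_le_pow₀ hlog1
    have e1 : K * (Real.log N ^ 2 * b) ≤ K * (Real.log N ^ 2 * 2) := by gcongr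
    have e2 := mul_le_mul_of_nonneg_left hsq hK
    have e3 : 0 ≤ (4 * K / c ^ 2 + 1) * Real.log N ^ 2 := by positivity
    linarith
  · intro h1 h2
    have hsm4 : β * (4 * lam / N) / 2 = q * (Real.log N / N) := by
      rw [hβ, hq, hlam]
      field_simp
    have hdecay := barrier_le (a := q * (Real.log N / N) / Real.cosh q) (i := i) hκ0 hA hκA
      (fun j hj hjn => by
        have hj' : h j = 4 * lam / N := by
          rcases hjn with h3 | h3
          · exact shishkinStep_of_lt hn h3
          · exact shishkinStep_of_ge (by omega) hj
        have := div_cosh_le_Acoef (c := q) (hβh j hj) (by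
          rw [hj', hsm4]
          exact mul_le_of_le_one_right (by positivity) ((div_le_one hN0).2 hlogN))
        rwa [hj', hsm4, ← hj'] at this) h1 (by omega)
    have hexp : κ * (q * (Real.log N / N) / Real.cosh q) * n = c * Real.log N := by
      have hκq : κ * q = 2 := by
        rw [hκ, hq]
        field_simp
        norm_num
      have hnN : (n : ℝ) / N = 1 / 4 := by
        rw [hNn]
        field_simp
      rw [show κ * (q * (Real.log N / N) / Real.cosh q) * n =
        κ * q * Real.log N * (n / N) / Real.cosh q by ring, hκq, hnN, hc]
      ring
    rw [hexp] at hdecay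
    refine he.trans (div_le_div_of_nonneg_right ?_ (by positivity))
    have e1 : K * (Real.log N ^ 2 * b) ≤
        K * (Real.log N ^ 2 * (2 * Real.exp (-(c * Real.log N)))) := by gcongr
    have e2 := mul_le_mul_of_nonneg_left
      (sq_mul_exp_neg_le hc0 (zero_le_one.trans hlog1)) hK
    have e3 : K * (2 / c ^ 2) = 2 * (K / c ^ 2) := by ring
    have e4 : 4 * K / c ^ 2 = 4 * (K / c ^ 2) := by ring
    linarith

/-- ε-uniform convergence of the scheme on the modified Shishkin mesh: if
`ε ≤ C₀/N` and `λ = min{2ε ln N/√m, 1/4}`, the solution `ȳ` of the discrete problem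
`Tȳ = 0` satisfies `|y(x_i) − ȳ_i| ≤ C (ln² N)/N²` in the layer regions
(`i ≤ N/4−1` and `i ≥ 3N/4+1`) and `|y(x_i) − ȳ_i| ≤ C/N²` in the middle region
(`N/4 ≤ i ≤ 3N/4`). -/
theorem uniform_convergence
    (m γ : ℝ) (k : ℕ) (f : ℝ → ℝ → ℝ)
    (hm : 0 < m) (hk : 2 ≤ k)
    (hf : ContDiffOn ℝ k (Function.uncurry f) (Set.Icc 0 1 ×ˢ Set.univ))
    (hfy : ∀ a ∈ Set.Icc (0:ℝ) 1, ∀ u : ℝ, m ≤ deriv (f a) u)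
    (hγ : ∀ a ∈ Set.Icc (0:ℝ) 1, ∀ u : ℝ, deriv (f a) u ≤ γ) :
    ∃ C₀ > (0:ℝ), ∃ C > (0:ℝ), ∀ (ε : ℝ) (N : ℕ) (y : ℝ → ℝ),
      0 < ε → ε < 1 → 0 < N → 4 ∣ N → ε ≤ C₀ / N →
      ContDiffOn ℝ 2 y (Set.Icc 0 1) → y 0 = 0 → y 1 = 0 →
      (∀ a ∈ Set.Ioo (0:ℝ) 1,
        ε ^ 2 * iteratedDerivWithin 2 y (Set.Icc 0 1) a = f a (y a)) →
      let lam : ℝ := min (2 * ε * Real.log N / Real.sqrt m) (1 / 4)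
      let β : ℝ := Real.sqrt γ / ε
      let x : ℕ → ℝ := fun i => shishkinPsi lam ((i : ℝ) / (N : ℝ))
      ∀ ybar : ℕ → ℝ, (∀ i : ℕ, i ≤ N → Tdisc f γ β x N ybar i = 0) →
        (∀ i : ℕ, i ≤ N / 4 - 1 →
          |y (x i) - ybar i| ≤ C * (Real.log N) ^ 2 / (N : ℝ) ^ 2) ∧
        (∀ i : ℕ, N / 4 ≤ i → i ≤ 3 * N / 4 →
          |y (x i) - ybar i| ≤ C / (N : ℝ) ^ 2) ∧
        (∀ i : ℕ, 3 * N / 4 + 1 ≤ i → i ≤ N →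
          |y (x i) - ybar i| ≤ C * (Real.log N) ^ 2 / (N : ℝ) ^ 2) := by
  have hsm : 0 < Real.sqrt m := Real.sqrt_pos.2 hm
  obtain ⟨C, hC, hmain⟩ := exists_shishkin_error_bound hm hk hf hfy hγ
  refine ⟨min 1 (Real.sqrt m / 8), by positivity, C, hC, ?_⟩
  intro ε N y hε _ hN hdvd hεN hy h0 h1 hode lam β x ybar hT
  obtain ⟨n, rfl⟩ := hdvd
  have hn : 0 < n := by omega
  have hN0 : (0 : ℝ) < (4 * n : ℕ) := by exact_mod_cast hN
  have hlogN : Real.log (4 * n : ℕ) ≤ (4 * n : ℕ) :=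
    (Real.log_le_sub_one_of_pos hN0).trans (by linarith)
  have hε1 : ε ≤ 1 / (4 * n : ℕ) :=
    hεN.trans (div_le_div_of_nonneg_right (min_le_left _ _) hN0.le)
  have hε8 : ε ≤ Real.sqrt m / 8 / (4 * n : ℕ) :=
    hεN.trans (div_le_div_of_nonneg_right (min_le_right _ _) hN0.le)
  have hle : 2 * ε * Real.log (4 * n : ℕ) / Real.sqrt m ≤ 1 / 4 := by
    rw [div_le_iff₀ hsm]
    rw [le_div_iff₀ hN0] at hε8
    have := mul_le_mul_of_nonneg_left hlogN hε.le
    linarith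
  have hlam : lam = 2 * ε * Real.log (4 * n : ℕ) / Real.sqrt m := min_eq_left hle
  have key := hmain ε lam n y _ _ ybar hn hε hε1 (isClassicalSolution_of_contDiffOn hy h0 h1 hode)
    hlam (hlam.trans_le hle) hT
  exact ⟨fun i hi => (key i (by omega)).1,
    fun i hi1 hi2 => (key i (by omega)).2 (by omega) (by omega),
    fun i _ hi => (key i hi).1⟩
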